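/- There exists Y > 0 such that for all σ, τ in the upper half-plane with Im σ > Y and Im τ > Y, the infinite product converges absolutely and p^{-1} · ∏_{d=1}^∞ ∏_{r ∈ ℤ} (1 − (−1)^r p^d q^{r/2})^{C_{d mod 2, r mod 2}(rd/2)} = f̃_NS(2σ) + f_NS(τ). Here all factors with rd/2 < −1/2 have exponent zero, and the unique factor with a negative power of q is (1 + p q^{-1/2}), coming from (d,r) = (1,−1). -/

import Mathlib

open scoped Real

/-- The Dedekind eta function `η(τ) = e^{πiτ/12} ∏_{n=1}^∞ (1 - e^{2πinτ})`. -/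
noncomputable def eta (τ : ℂ) : ℂ :=
  Complex.exp (Real.pi * Complex.I * τ / 12) *
    ∏' n : ℕ, (1 - Complex.exp (2 * Real.pi * Complex.I * (n + 1) * τ))

/-- `f_NS(τ) = η(τ)^48/(η(τ/2)^24 η(2τ)^24) − 24`. -/
noncomputable def fNS (τ : ℂ) : ℂ :=
  eta τ ^ 48 / (eta (τ / 2) ^ 24 * eta (2 * τ) ^ 24) - 24

/-- `f̃_NS(τ) = η(τ/2)^24/η(τ)^24 + 24`. -/
noncomputable def ftNS (τ : ℂ) : ℂ :=
  eta (τ / 2) ^ 24 / eta τ ^ 24 + 24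

/-- `f_R(τ) = 2^12 η(2τ)^24/η(τ)^24 + 24`. -/
noncomputable def fR (τ : ℂ) : ℂ :=
  2 ^ 12 * eta (2 * τ) ^ 24 / eta τ ^ 24 + 24

/-- The vector-valued function with components `F_{0,0} = (f_NS − f̃_NS)/2`,
    `F_{0,1} = −(f_R + 24)/2`, `F_{1,0} = −F_{0,0}`, `F_{1,1} = (f_NS + f̃_NS)/2`. -/
noncomputable def Fcomp (i j : ZMod 2) (τ : ℂ) : ℂ :=
  if i = 0 then (if j = 0 then (fNS τ - ftNS τ) / 2 else -(fR τ + 24) / 2)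
  else (if j = 0 then (ftNS τ - fNS τ) / 2 else (fNS τ + ftNS τ) / 2)

lemma eta_eq (z : ℂ) : eta z = ModularForm.eta z := by
  unfold eta ModularForm.eta
  congr 1
  · unfold Function.Periodic.qParam
    congr 1
    push_cast
    ring
  · simp only [ModularForm.eta_q_eq_cexp]

lemma eta_ne {z : ℂ} (hz : 0 < z.im) : eta z ≠ 0 := by
  rw [eta_eq]; exact ModularForm.eta_ne_zero hz

lemma eta_diff {z : ℂ} (hz : 0 < z.im) : DifferentiableAt ℂ eta z := by
  have : eta = ModularForm.eta := funext eta_eq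
  rw [this]; exact ModularForm.differentiableAt_eta_of_mem_upperHalfPlaneSet hz

lemma eta_S {z : ℂ} (hz : 0 < z.im) : eta (-1 / z) ^ 24 = z ^ 12 * eta z ^ 24 := by
  have h := congrFun ModularForm.discriminant_S_invariant ⟨z, hz⟩
  have hz0 : z ≠ 0 := by rintro rfl; simp at hz
  rw [ModularForm.SL_slash_apply, UpperHalfPlane.modular_S_smul, ModularGroup.denom_S] at h
  simp [ModularForm.discriminant, ← eta_eq] at h
  rw [neg_div, one_div, ← h]
  field_simp

lemma im_S {z : ℂ} (hz : 0 < z.im) : 0 < (-1 / z).im := by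
  have hz0 : z ≠ 0 := by rintro rfl; simp at hz
  rw [neg_div, one_div, Complex.neg_im, Complex.inv_im]
  have := Complex.normSq_pos.2 hz0
  rw [neg_div, neg_neg]; positivity

lemma im_half {z : ℂ} (hz : 0 < z.im) : 0 < (z / 2).im := by
  have : (z/2).im = z.im / 2 := by
    simp
  rw [this]; positivity
lemma im_two {z : ℂ} (hz : 0 < z.im) : 0 < (2 * z).im := by
  simp; positivity

lemma ft_S {z : ℂ} (hz : 0 < z.im) : ftNS (-1 / z) = fR z := by
  have hz0 : z ≠ 0 := by rintro rfl; simp at hz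
  unfold ftNS fR
  have h1 := eta_S hz
  have h2 := eta_S (im_two hz)
  have e : -1 / z / 2 = -1 / (2 * z) := by field_simp
  rw [e, h1, h2]
  have := eta_ne hz
  field_simp

lemma fR_S {z : ℂ} (hz : 0 < z.im) : fR (-1 / z) = ftNS z := by
  have hz0 : z ≠ 0 := by rintro rfl; simp at hz
  rw [← ft_S (im_S hz)]
  congr 1
  field_simp

lemma fNS_S {z : ℂ} (hz : 0 < z.im) : fNS (-1 / z) = fNS z := by
  have hz0 : z ≠ 0 := by rintro rfl; simp at hz
  unfold fNS
  have h1 := eta_S hz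
  have h2 := eta_S (im_two hz)
  have h3 := eta_S (im_half hz)
  have e : -1 / z / 2 = -1 / (2 * z) := by field_simp
  have e' : 2 * (-1 / z) = -1 / (z / 2) := by field_simp
  have e3 : eta (-1 / z) ^ 48 = (eta (-1 / z) ^ 24) ^ 2 := by ring
  rw [e, e', e3, h1, h2, h3]
  have := eta_ne hz
  have := eta_ne (im_two hz)
  have := eta_ne (im_half hz)
  field_simp

lemma prod_ABR {z : ℂ} (hz : 0 < z.im) : (fNS z + 24) * (ftNS z - 24) * (fR z - 24) = 2 ^ 12 := by
  unfold fNS ftNS fR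
  have := eta_ne hz
  have := eta_ne (im_two hz)
  have := eta_ne (im_half hz)
  generalize eta (2 * z) = u at *
  generalize eta (z / 2) = v at *
  field_simp
  ring

lemma fNS_diff {z : ℂ} (hz : 0 < z.im) : DifferentiableAt ℂ fNS z := by
  unfold fNS
  have h0 := eta_ne hz
  have h1 := eta_ne (im_two hz)
  have h2 := eta_ne (im_half hz)
  have a0 := eta_diff hz
  have a1 : DifferentiableAt ℂ (fun z => eta (2 * z)) z :=
    (eta_diff (im_two hz)).fun_comp' z (by fun_prop)
  have a2 : DifferentiableAt ℂ (fun z => eta (z / 2)) z :=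
    (eta_diff (im_half hz)).fun_comp' (f := fun z => z / 2) z (by fun_prop)
  refine ((a0.pow 48).div ((a2.pow 24).mul (a1.pow 24)) ?_).sub_const 24
  simp [h1, h2]

lemma ftNS_diff {z : ℂ} (hz : 0 < z.im) : DifferentiableAt ℂ ftNS z := by
  unfold ftNS
  have h0 := eta_ne hz
  have a0 := eta_diff hz
  have a2 : DifferentiableAt ℂ (fun z => eta (z / 2)) z :=
    (eta_diff (im_half hz)).fun_comp' (f := fun z => z / 2) z (by fun_prop)
  refine ((a2.pow 24).div (a0.pow 24) ?_).add_const 24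
  simp [h0]

lemma fR_diff {z : ℂ} (hz : 0 < z.im) : DifferentiableAt ℂ fR z := by
  unfold fR
  have h0 := eta_ne hz
  have a0 := eta_diff hz
  have a1 : DifferentiableAt ℂ (fun z => eta (2 * z)) z :=
    (eta_diff (im_two hz)).fun_comp' z (by fun_prop)
  refine (((a1.pow 24).const_mul _).div (a0.pow 24) ?_).add_const 24
  simp [h0]

open UpperHalfPlane ModularForm SlashInvariantForm in
lemma const_of_SL2 (f : ℂ → ℂ) (hd : ∀ z : ℂ, 0 < z.im → DifferentiableAt ℂ f z)
    (hT : ∀ z : ℂ, 0 < z.im → f (z + 1) = f z) (hS : ∀ z : ℂ, 0 < z.im → f (-1 / z) = f z)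
    (hb : ∃ M B : ℝ, ∀ z : ℂ, B ≤ z.im → ‖f z‖ ≤ M) : ∃ κ, ∀ z : ℂ, 0 < z.im → f z = κ := by
  have hS' : ((fun z : ℍ => f z) ∣[(0 : ℤ)] ModularGroup.S) = (fun z : ℍ => f z) := by
    ext z
    rw [ModularForm.SL_slash_apply, UpperHalfPlane.modular_S_smul]
    simp only [neg_zero, zpow_zero, mul_one]
    rw [← hS z z.2]
    congr 1
    simp [neg_div]
  have hT' : ((fun z : ℍ => f z) ∣[(0 : ℤ)] ModularGroup.T) = (fun z : ℍ => f z) := by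
    ext z
    rw [ModularForm.SL_slash_apply, UpperHalfPlane.modular_T_smul]
    simp only [neg_zero, zpow_zero, mul_one]
    rw [← hT z z.2]
    congr 1
    simp [add_comm]
  let F : ModularForm (Matrix.SpecialLinearGroup.mapGL ℝ : Matrix.SpecialLinearGroup (Fin 2) ℤ →* _).range 0 :=
    { toFun := fun z => f z
      slash_action_eq' := by
        intro A hA
        obtain ⟨A, rfl⟩ := hA
        exact slash_action_generators_SL2Z hS' hT' A
      holo' := by
        rw [UpperHalfPlane.mdifferentiable_iff]
        refine .congr (fun z hz ↦ (hd z hz).differentiableWithinAt) fun z hz ↦ ?_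
        simp [ofComplex_apply_of_im_pos hz]
      bdd_at_cusps' := by
        intro c hc
        rw [Subgroup.IsArithmetic.isCusp_iff_isCusp_SL2Z] at hc
        rw [OnePoint.isBoundedAt_iff_forall_SL2Z hc]
        intro γ _
        rw [slash_action_generators_SL2Z hS' hT']
        rw [isBoundedAtImInfty_iff]
        obtain ⟨M, B, h⟩ := hb
        exact ⟨M, B, fun z hz => h z hz⟩ }
  obtain ⟨κ, hκ⟩ := ModularFormClass.levelOne_weight_zero_const F
  exact ⟨κ, fun z hz => congrFun hκ ⟨z, hz⟩⟩

lemma const_of_triple (f0 f1 f2 : ℂ → ℂ)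
    (hd0 : ∀ z : ℂ, 0 < z.im → DifferentiableAt ℂ f0 z)
    (hd1 : ∀ z : ℂ, 0 < z.im → DifferentiableAt ℂ f1 z)
    (hd2 : ∀ z : ℂ, 0 < z.im → DifferentiableAt ℂ f2 z)
    (hT0 : ∀ z : ℂ, 0 < z.im → f0 (z + 1) = f1 z)
    (hT1 : ∀ z : ℂ, 0 < z.im → f1 (z + 1) = f0 z)
    (hT2 : ∀ z : ℂ, 0 < z.im → f2 (z + 1) = f2 z)
    (hS0 : ∀ z : ℂ, 0 < z.im → f0 (-1 / z) = f2 z)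
    (hS1 : ∀ z : ℂ, 0 < z.im → f1 (-1 / z) = f1 z)
    (hS2 : ∀ z : ℂ, 0 < z.im → f2 (-1 / z) = f0 z)
    (hb0 : ∃ M B : ℝ, 0 < B ∧ ∀ z : ℂ, B ≤ z.im → ‖f0 z‖ ≤ M)
    (hb2 : ∃ M B : ℝ, 0 < B ∧ ∀ z : ℂ, B ≤ z.im → ‖f2 z‖ ≤ M) :
    ∀ z w : ℂ, 0 < z.im → 0 < w.im → f0 z = f0 w := by
  obtain ⟨M0, B0, hB0, hb0⟩ := hb0
  obtain ⟨M2, B2, hB2, hb2⟩ := hb2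
  have hI : (0:ℝ) < Complex.I.im := by simp
  set k := f0 Complex.I with hk
  have bd : ∀ (f : ℂ → ℂ) (M : ℝ) z, ‖f z‖ ≤ M → ‖f z - k‖ ≤ M + ‖k‖ := fun f M z h =>
    (norm_sub_le _ _).trans (by gcongr)
  obtain ⟨κ, hκ⟩ := const_of_SL2 (fun z => (f0 z - k) * (f1 z - k) * (f2 z - k))
    (fun z hz => (((hd0 z hz).sub_const k).mul ((hd1 z hz).sub_const k)).mul
      ((hd2 z hz).sub_const k))
    (fun z hz => by simp only [hT0 z hz, hT1 z hz, hT2 z hz]; ring)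
    (fun z hz => by simp only [hS0 z hz, hS1 z hz, hS2 z hz]; ring)
    ⟨(M0 + ‖k‖) * (M0 + ‖k‖) * (M2 + ‖k‖), max B0 B2, fun z hz => by
      have h0 := hb0 z (le_trans (le_max_left _ _) hz)
      have h2 := hb2 z (le_trans (le_max_right _ _) hz)
      have hz0 : 0 < z.im := lt_of_lt_of_le hB0 (le_trans (le_max_left _ _) hz)
      have h1 : ‖f1 z‖ ≤ M0 := by
        rw [← hT0 z hz0]
        apply hb0
        simpa using le_trans (le_max_left _ _) hz
      have a0 := bd f0 M0 z h0
      have a1 := bd f1 M0 z h1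
      have a2 := bd f2 M2 z h2
      have := (norm_nonneg _).trans a0
      have := (norm_nonneg _).trans a2
      simp only [norm_mul]
      gcongr⟩
  have hκ0 : κ = 0 := by rw [← hκ _ hI]; simp [hk]
  subst hκ0
  let U : Set ℂ := {z | 0 < z.im}
  have hU : IsOpen U := isOpen_lt continuous_const Complex.continuous_im
  have hUc : IsPreconnected U := (convex_halfSpace_im_gt 0).isPreconnected
  have an : ∀ f : ℂ → ℂ, (∀ z : ℂ, 0 < z.im → DifferentiableAt ℂ f z) →
      AnalyticOnNhd ℂ (fun z => f z - k) U := fun f hf =>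
    DifferentiableOn.analyticOnNhd (fun z hz => ((hf z hz).sub_const k).differentiableWithinAt) hU
  have a0 := an f0 hd0
  have a1 := an f1 hd1
  have a2 := an f2 hd2
  have key : ∀ z : ℂ, 0 < z.im → f0 z = k := by
    have e1 : (∀ z ∈ U, ((fun z => f0 z - k) * (fun z => f1 z - k)) z = 0) ∨
        (∀ z ∈ U, (fun z => f2 z - k) z = 0) := by
      apply AnalyticOnNhd.eq_zero_or_eq_zero_of_mul_eq_zero (a0.mul a1) a2 _ hUc
      intro z hz
      simpa using hκ z hz
    rcases e1 with e1 | e1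
    · rcases AnalyticOnNhd.eq_zero_or_eq_zero_of_mul_eq_zero a0 a1 e1 hUc with e2 | e2
      · intro z hz; exact sub_eq_zero.1 (e2 z hz)
      · intro z hz
        have := sub_eq_zero.1 (e2 (z + 1) (by simpa [U] using hz))
        rwa [hT1 z hz] at this
    · intro z hz
      have := sub_eq_zero.1 (e1 (-1 / z) (im_S hz))
      rwa [hS2 z hz] at this
  intro z w hz hw
  rw [key z hz, key w hw]

structure CD (c : ZMod 2 → ZMod 2 → ℤ → ℤ) : Prop where
  hexp : ∀ (i j : ZMod 2) (τ : ℂ), 0 < τ.im →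
      HasSum (fun m : ℤ => (c i j m : ℂ) * Complex.exp (Real.pi * Complex.I * τ * m))
        (Fcomp i j τ)
  h00 : ∀ m : ℤ, m < 0 ∨ ¬ (2 ∣ m) → c 0 0 m = 0
  h01 : ∀ m : ℤ, m < 0 ∨ ¬ (2 ∣ m) → c 0 1 m = 0
  h10 : ∀ m : ℤ, c 1 0 m = - c 0 0 m
  h11 : ∀ m : ℤ, m < -1 ∨ 2 ∣ m → c 1 1 m = 0
  h11p : c 1 1 (-1) = 1

lemma hsc {ι : Type*} {f g : ι → ℂ} {a b : ℂ} (h : HasSum f a) (hf : ∀ m, g m = f m) (hab : b = a) :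
    HasSum g b := by
  rw [hab, show g = f from funext hf]; exact h

noncomputable def ex (z : ℂ) (m : ℤ) : ℂ := Complex.exp (Real.pi * Complex.I * z * m)

lemma norm_ex (z : ℂ) (m : ℤ) : ‖ex z m‖ = Real.exp (-π * z.im * m) := by
  rw [ex, Complex.norm_exp]
  congr 1
  simp

lemma ex_ne (z : ℂ) (m : ℤ) : ex z m ≠ 0 := Complex.exp_ne_zero _

lemma ex_zpow (z : ℂ) (m : ℤ) : ex z m = ex z 1 ^ m := by
  rw [ex, ex, ← Complex.exp_int_mul]; congr 1; push_cast; ring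

lemma ex_one_add (z : ℂ) (m : ℤ) : ex (z + 1) m = ex z m * (-1) ^ m := by
  have : ((-1 : ℂ)) ^ m = Complex.exp (π * Complex.I * m) := by
    rw [← Complex.exp_pi_mul_I, ← Complex.exp_int_mul]; congr 1; ring
  rw [this, ex, ex, ← Complex.exp_add]; congr 1; ring

lemma bnd (a : ℤ → ℂ) (N : ℤ) (hN : ∀ m < N, a m = 0) (t : ℝ)
    (hs : Summable fun m : ℤ => ‖a m‖ * Real.exp (-π * t * m)) :
    ∃ M : ℝ, 0 ≤ M ∧ ∀ (z S : ℂ), t ≤ z.im → HasSum (fun m => a m * ex z m) S →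
      ‖S‖ ≤ M * Real.exp (-π * N * (z.im - t)) := by
  refine ⟨∑' m : ℤ, ‖a m‖ * Real.exp (-π * t * m), tsum_nonneg fun m => by positivity, ?_⟩
  intro z S hz hS
  rw [← hS.tsum_eq, ← tsum_mul_right]
  apply tsum_of_norm_bounded (hs.mul_right _).hasSum
  intro m
  rw [norm_mul, norm_ex, mul_assoc ‖a m‖, ← Real.exp_add]
  rcases lt_or_ge m N with h | h
  · simp [hN m h]
  · gcongr
    have : (0:ℝ) ≤ π * ((m:ℝ) - N) * (z.im - t) := by
      have : (N:ℝ) ≤ m := by exact_mod_cast h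
      have := Real.pi_pos
      apply mul_nonneg (mul_nonneg _ _) <;> linarith
    nlinarith

lemma summable_norm_of_hasSum (a : ℤ → ℂ) (t : ℝ) (S : ℂ)
    (h : HasSum (fun m => a m * ex (t * Complex.I) m) S) :
    Summable fun m : ℤ => ‖a m‖ * Real.exp (-π * t * m) := by
  have := h.summable.norm
  simpa [norm_ex] using this

lemma lead (a : ℤ → ℂ) (N : ℤ) (hN : ∀ m < N, a m = 0) (S : ℂ → ℂ)
    (hS : ∀ z : ℂ, 0 < z.im → HasSum (fun m => a m * ex z m) (S z))
    (hlim : Filter.Tendsto (fun y : ℝ => ‖S (y * Complex.I)‖ * Real.exp (π * N * y)) Filter.atTop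
      (nhds 0)) : a N = 0 := by
  have hs := summable_norm_of_hasSum a 1 _ (hS (((1:ℝ):ℂ) * Complex.I) (by simp))
  set b : ℤ → ℂ := fun m => if m = N then 0 else a m with hb
  have hbs : Summable fun m : ℤ => ‖b m‖ * Real.exp (-π * 1 * m) := by
    refine Summable.of_nonneg_of_le (fun m => by positivity) (fun m => ?_) hs
    simp only [hb]; split_ifs
    · simp; positivity
    · rfl
  obtain ⟨M, hM, hbd⟩ := bnd b (N + 1) (fun m hm => by
    simp only [hb]; split_ifs with h
    · rfl
    · exact hN m (by omega)) 1 hbs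
  have key : ∀ y : ℝ, 1 ≤ y → ‖a N‖ ≤ ‖S (y * Complex.I)‖ * Real.exp (π * N * y)
      + M * Real.exp (π * (N + 1)) * Real.exp (-(π * y)) := by
    intro y hy
    have hz : 0 < (y * Complex.I).im := by simp; linarith
    have h1 := hS _ hz
    have h2 : HasSum (fun m => if m = N then a N * ex (y * Complex.I) N else 0)
      (a N * ex (y * Complex.I) N) := hasSum_ite_eq N _
    have h3 := h1.sub h2
    have h4 : HasSum (fun m => b m * ex (y * Complex.I) m)
        (S (y * Complex.I) - a N * ex (y * Complex.I) N) := by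
      refine hsc h3 (fun m => ?_) rfl
      by_cases hm : m = N
      · subst hm; simp [hb]
      · simp [hb, hm]
    have h5 := hbd _ _ (by simpa using hy) h4
    have h6 : ‖a N * ex (y * Complex.I) N‖ ≤ ‖S (y * Complex.I)‖ +
        ‖S (y * Complex.I) - a N * ex (y * Complex.I) N‖ := by
      have := norm_sub_norm_le (a N * ex (y * Complex.I) N) (S (y * Complex.I))
      rw [norm_sub_rev] at this
      linarith
    have h7 := h6.trans (add_le_add le_rfl h5)
    rw [norm_mul, norm_ex] at h7
    have e0 := mul_le_mul_of_nonneg_right h7 (Real.exp_pos (π * N * y)).le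
    simp only [Complex.mul_im, Complex.ofReal_re, Complex.I_im, mul_one, Complex.ofReal_im,
      Complex.I_re, mul_zero, add_zero] at e0
    rw [mul_assoc, ← Real.exp_add, add_mul, mul_assoc M, ← Real.exp_add] at e0
    rw [mul_assoc M, ← Real.exp_add]
    rw [show -π * y * N + π * N * y = 0 by ring, Real.exp_zero, mul_one,
      show -π * ((N + 1 : ℤ) : ℝ) * (y - 1) + π * N * y = π * (N + 1) + -(π * y) by
        push_cast; ring] at e0
    exact e0
  have l2 : Filter.Tendsto (fun y : ℝ => M * Real.exp (π * (N + 1)) * Real.exp (-(π * y)))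
      Filter.atTop (nhds 0) := by
    have : Filter.Tendsto (fun y : ℝ => Real.exp (-(π * y))) Filter.atTop (nhds 0) :=
      Real.tendsto_exp_neg_atTop_nhds_zero.comp
        (Filter.tendsto_id.const_mul_atTop Real.pi_pos)
    simpa using this.const_mul (M * Real.exp (π * (N + 1)))
  have l3 := hlim.add l2
  rw [add_zero] at l3
  have := ge_of_tendsto l3 (Filter.eventually_atTop.2 ⟨1, key⟩)
  simpa using this

lemma uniq (a : ℤ → ℂ) (N : ℤ) (hN : ∀ m < N, a m = 0)
    (hS : ∀ z : ℂ, 0 < z.im → HasSum (fun m => a m * ex z m) 0) : ∀ m, a m = 0 := by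
  have : ∀ n : ℕ, ∀ m < N + n, a m = 0 := by
    intro n
    induction n with
    | zero => simpa using hN
    | succ n ih =>
      intro m hm
      rcases lt_or_ge m (N + n) with h | h
      · exact ih m h
      · have : m = N + n := by push_cast at hm; omega
        rw [this]
        exact lead a (N + n) ih (fun _ => 0) hS (by simp)
  intro m
  exact this (m - N + 1).toNat m (by omega)

namespace CD
variable {c : ZMod 2 → ZMod 2 → ℤ → ℤ}

lemma s00 (h : CD c) {z : ℂ} (hz : 0 < z.im) :
    HasSum (fun m => (c 0 0 m : ℂ) * ex z m) ((fNS z - ftNS z) / 2) := by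
  simpa [Fcomp, ex] using h.hexp 0 0 z hz
lemma s01 (h : CD c) {z : ℂ} (hz : 0 < z.im) :
    HasSum (fun m => (c 0 1 m : ℂ) * ex z m) (-(fR z + 24) / 2) := by
  simpa [Fcomp, ex] using h.hexp 0 1 z hz
lemma s11 (h : CD c) {z : ℂ} (hz : 0 < z.im) :
    HasSum (fun m => (c 1 1 m : ℂ) * ex z m) ((fNS z + ftNS z) / 2) := by
  simpa [Fcomp, ex] using h.hexp 1 1 z hz
lemma sft (h : CD c) {z : ℂ} (hz : 0 < z.im) :
    HasSum (fun m => ((c 1 1 m - c 0 0 m : ℤ) : ℂ) * ex z m) (ftNS z) := by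
  refine hsc ((h.s11 hz).sub (h.s00 hz)) (fun m => ?_) ?_
  · push_cast; ring
  · ring
lemma sNS (h : CD c) {z : ℂ} (hz : 0 < z.im) :
    HasSum (fun m => ((c 1 1 m + c 0 0 m : ℤ) : ℂ) * ex z m) (fNS z) := by
  convert (h.s11 hz).add (h.s00 hz) using 1
  · ext m; push_cast; ring
  · ring
lemma ft_sign (h : CD c) (m : ℤ) :
    ((c 1 1 m - c 0 0 m : ℤ) : ℂ) * (-1) ^ m = -((c 1 1 m + c 0 0 m : ℤ) : ℂ) := by
  rcases Int.even_or_odd m with hm | hm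
  · rw [hm.neg_one_zpow, h.h11 m (Or.inr hm.two_dvd)]; simp
  · rw [hm.neg_one_zpow, h.h00 m (Or.inr (by rw [← even_iff_two_dvd]; simpa using hm))]; simp
lemma im1 {z : ℂ} (hz : 0 < z.im) : 0 < (z + 1).im := by simpa using hz
lemma ft_T (h : CD c) {z : ℂ} (hz : 0 < z.im) : ftNS (z + 1) = - fNS z := by
  refine (h.sft (im1 hz)).unique ?_
  refine hsc (h.sNS hz).neg (fun m => ?_) rfl
  rw [ex_one_add, ← neg_mul, ← h.ft_sign]; ring
lemma NS_T (h : CD c) {z : ℂ} (hz : 0 < z.im) : fNS (z + 1) = - ftNS z := by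
  refine (h.sNS (im1 hz)).unique ?_
  refine hsc (h.sft hz).neg (fun m => ?_) rfl
  rw [ex_one_add]
  have := h.ft_sign m
  have e : ((-1 : ℂ)) ^ m * (-1) ^ m = 1 := by rw [← mul_zpow]; simp
  linear_combination (ex z m * (-1) ^ m) * this - (ex z m * ((c 1 1 m - c 0 0 m : ℤ) : ℂ)) * e
lemma R_T (h : CD c) {z : ℂ} (hz : 0 < z.im) : fR (z + 1) = fR z := by
  have : -(fR (z+1) + 24) / 2 = -(fR z + 24) / 2 := by
    refine (h.s01 (im1 hz)).unique ?_
    convert h.s01 hz using 2 with m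
    rw [ex_one_add]
    rcases Int.even_or_odd m with hm | hm
    · rw [hm.neg_one_zpow]; simp
    · rw [h.h01 m (Or.inr (by rw [← even_iff_two_dvd]; simpa using hm))]; simp
  linear_combination (-2) * this

lemma bd00 (h : CD c) : ∃ M : ℝ, 0 ≤ M ∧ ∀ z : ℂ, 1 ≤ z.im → ‖(fNS z - ftNS z) / 2‖ ≤ M := by
  obtain ⟨M, hM, hb⟩ := bnd (fun m => (c 0 0 m : ℂ)) 0 (fun m hm => by simp [h.h00 m (Or.inl hm)]) 1
    (summable_norm_of_hasSum _ 1 _ (h.s00 (by simp)))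
  exact ⟨M, hM, fun z hz => by simpa using hb z _ hz (h.s00 (by linarith))⟩
lemma bd01 (h : CD c) : ∃ M : ℝ, 0 ≤ M ∧ ∀ z : ℂ, 1 ≤ z.im → ‖-(fR z + 24) / 2‖ ≤ M := by
  obtain ⟨M, hM, hb⟩ := bnd (fun m => (c 0 1 m : ℂ)) 0 (fun m hm => by simp [h.h01 m (Or.inl hm)]) 1
    (summable_norm_of_hasSum _ 1 _ (h.s01 (by simp)))
  exact ⟨M, hM, fun z hz => by simpa using hb z _ hz (h.s01 (by linarith))⟩
lemma bd11 (h : CD c) : ∃ M : ℝ, 0 ≤ M ∧ ∀ z : ℂ, 1 ≤ z.im →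
    ‖(fNS z + ftNS z) / 2 - ex z (-1)‖ ≤ M := by
  have key : ∀ z : ℂ, 0 < z.im → HasSum (fun m => (if m = -1 then 0 else (c 1 1 m : ℂ)) * ex z m)
      ((fNS z + ftNS z) / 2 - ex z (-1)) := by
    intro z hz
    refine hsc ((h.s11 hz).sub (hasSum_ite_eq (-1) (ex z (-1)))) (fun m => ?_) rfl
    split_ifs with hm
    · subst hm; simp [h.h11p]
    · simp
  obtain ⟨M, hM, hb⟩ := bnd _ 0 (fun m hm => by
    split_ifs with h1
    · rfl
    · rw [h.h11 m (by omega)]; simp) 1 (summable_norm_of_hasSum _ 1 _ (key _ (by simp)))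
  exact ⟨M, hM, fun z hz => by simpa using hb z _ hz (key z (by linarith))⟩

lemma ident (h : CD c) : ∀ z : ℂ, 0 < z.im → ftNS z - fNS z + fR z = 24 := by
  obtain ⟨κ, hκ⟩ := const_of_SL2 (fun z => ftNS z - fNS z + fR z)
    (fun z hz => ((ftNS_diff hz).sub (fNS_diff hz)).add (fR_diff hz))
    (fun z hz => by simp only [h.ft_T hz, h.NS_T hz, h.R_T hz]; ring)
    (fun z hz => by simp only [ft_S hz, fNS_S hz, fR_S hz]; ring)
    (by
      obtain ⟨M0, -, h0⟩ := h.bd00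
      obtain ⟨M1, -, h1⟩ := h.bd01
      refine ⟨2 * M0 + 2 * M1 + 24, 1, fun z hz => ?_⟩
      have e : ftNS z - fNS z + fR z = -2 * ((fNS z - ftNS z) / 2) + (-2) * (-(fR z + 24) / 2) + (-24) := by
        ring
      simp only [e]
      refine (norm_add₃_le).trans ?_
      simp only [norm_mul, norm_neg, Complex.norm_ofNat]
      gcongr
      · exact h0 z hz
      · exact h1 z hz)
  -- real
  have im0 : ∀ (a : ℤ → ℤ) (S : ℂ), HasSum (fun m => (a m : ℂ) * ex Complex.I m) S → S.im = 0 := by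
    intro a S hS
    have := Complex.imCLM.hasSum hS
    refine this.unique ?_
    convert hasSum_zero using 2 with m
    have : ex Complex.I m = ((Real.exp (-π * m) : ℝ) : ℂ) := by
      rw [ex, Complex.ofReal_exp]; congr 1; push_cast
      linear_combination (π * m : ℂ) * Complex.I_mul_I
    simp only [this]
    simp [-Complex.ofReal_exp]
  have hκim : κ.im = 0 := by
    rw [← hκ Complex.I (by simp)]
    have e1 := im0 _ _ (h.s00 (z := Complex.I) (by simp))
    have e2 := im0 _ _ (h.s01 (z := Complex.I) (by simp))
    have e : ftNS Complex.I - fNS Complex.I + fR Complex.I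
      = ((-2 : ℝ) : ℂ) * ((fNS Complex.I - ftNS Complex.I) / 2) + ((-2 : ℝ) : ℂ) * (-(fR Complex.I + 24) / 2) + ((-24 : ℝ) : ℂ) := by
      push_cast; ring
    rw [e, Complex.add_im, Complex.add_im, Complex.im_ofReal_mul, Complex.im_ofReal_mul, e1, e2]
    simp
  set ρ : ℂ := ⟨1/2, Real.sqrt 3 / 2⟩ with hρ
  have hρim : 0 < ρ.im := by simp [hρ]
  have hρ2 : ρ * ρ = ρ - 1 := by
    apply Complex.ext
    · simp [hρ]; nlinarith [Real.sq_sqrt (show (0:ℝ) ≤ 3 by norm_num)]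
    · simp [hρ]; ring
  have hρ0 : ρ ≠ 0 := by intro h0; rw [h0] at hρim; simp at hρim
  have hS : -1 / ρ = ρ - 1 := by field_simp; linear_combination -hρ2
  have hw : 0 < (ρ - 1).im := by simpa using hρim
  have q1 := ft_S hρim
  have q2 := h.ft_T hw
  have q3 := h.NS_T hw
  have q4 := fNS_S hρim
  rw [hS] at q1 q4
  rw [sub_add_cancel] at q2 q3
  have q5 := prod_ABR hρim
  have q6 := hκ ρ hρim
  have hA : fNS ρ = - fR ρ := by rw [q3, q1]
  have hB : ftNS ρ = fR ρ := by rw [q2, q4, hA]; ring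
  rw [hA, hB] at q5 q6
  have hk : fR ρ = κ / 3 := by linear_combination q6 / 3
  have hkr : κ = (κ.re : ℂ) := by apply Complex.ext <;> simp [hκim]
  rw [hk, hkr] at q5
  have q7 : (-(κ.re / 3) + 24) * (κ.re / 3 - 24) * (κ.re / 3 - 24) = (2:ℝ) ^ 12 := by
    exact_mod_cast q5
  have q8 : κ.re = 24 := by
    set t := κ.re / 3 - 24 with ht
    have : (t + 16) * (t ^ 2 - 16 * t + 256) = 0 := by nlinarith
    rcases mul_eq_zero.1 this with h1 | h1
    · linarith
    · nlinarith [sq_nonneg (t - 8)]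
  intro z hz
  rw [hκ z hz, hkr, q8]; norm_num

lemma c01 (h : CD c) (m : ℤ) (hm : m ≠ 0) : c 0 1 m = - c 0 0 m := by
  have := uniq (fun m => (c 0 0 m : ℂ) + c 0 1 m + if m = 0 then 24 else 0) 0
    (fun m hm => by simp [h.h00 m (Or.inl hm), h.h01 m (Or.inl hm), hm.ne])
    (fun z hz => by
      convert ((h.s00 hz).add (h.s01 hz)).add (hasSum_ite_eq (0:ℤ) (24:ℂ)) using 1
      · ext m
        split_ifs with hm
        · subst hm; simp [ex]
        · ring
      · linear_combination (1/2) * h.ident z hz) m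
  simp only [hm, if_false, add_zero] at this
  have : c 0 0 m + c 0 1 m = 0 := by exact_mod_cast this
  linarith

lemma c000 (h : CD c) : c 0 0 0 = 0 := by
  have := lead (fun m => (c 0 0 m : ℂ)) 0 (fun m hm => by simp [h.h00 m (Or.inl hm)])
    (fun z => (fNS z - ftNS z) / 2) (fun z hz => h.s00 hz) ?_
  · exact_mod_cast this
  simp only [Int.cast_zero, mul_zero, zero_mul, Real.exp_zero, mul_one]
  obtain ⟨M0, hM0, h0⟩ := h.bd00
  obtain ⟨M1, hM1, h1⟩ := h.bd11
  have key : ∀ y : ℝ, max 1 (M0 + M1 + 24) ≤ y →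
      ‖(fNS (y * Complex.I) - ftNS (y * Complex.I)) / 2‖ ≤ 2048 / y := by
    intro y hy
    have hy1 : 1 ≤ y := le_trans (le_max_left _ _) hy
    have hy2 := le_trans (le_max_right _ _) hy
    set z : ℂ := y * Complex.I with hz
    have hzi : z.im = y := by simp [hz]
    have hz0 : 0 < z.im := by rw [hzi]; linarith
    have b0 := h0 z (by rw [hzi]; exact hy1)
    have b1 := h1 z (by rw [hzi]; exact hy1)
    have hE : M0 + M1 + 24 + y ≤ ‖ex z (-1)‖ := by
      rw [norm_ex, hzi]
      have := Real.add_one_le_exp (π * y)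
      have h3 := Real.pi_gt_three
      have : 3 * y ≤ π * y := by nlinarith
      have e : -π * y * ((-1 : ℤ) : ℝ) = π * y := by push_cast; ring
      rw [e]; linarith
    have hA : y ≤ ‖fNS z + 24‖ := by
      have e : ex z (-1) = (fNS z + 24) - ((fNS z + ftNS z) / 2 - ex z (-1)) - (fNS z - ftNS z) / 2 - 24 := by ring
      have := norm_sub_le ((fNS z + 24) - ((fNS z + ftNS z) / 2 - ex z (-1)) - (fNS z - ftNS z) / 2) 24
      have := norm_sub_le ((fNS z + 24) - ((fNS z + ftNS z) / 2 - ex z (-1))) ((fNS z - ftNS z) / 2)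
      have := norm_sub_le (fNS z + 24) ((fNS z + ftNS z) / 2 - ex z (-1))
      rw [← e] at *
      have : ‖(24:ℂ)‖ = 24 := by simp
      linarith
    have hB : y ≤ ‖ftNS z - 24‖ := by
      have e : ex z (-1) = (ftNS z - 24) - ((fNS z + ftNS z) / 2 - ex z (-1)) + (fNS z - ftNS z) / 2 + 24 := by ring
      have := norm_add_le ((ftNS z - 24) - ((fNS z + ftNS z) / 2 - ex z (-1)) + (fNS z - ftNS z) / 2) 24
      have := norm_add_le ((ftNS z - 24) - ((fNS z + ftNS z) / 2 - ex z (-1))) ((fNS z - ftNS z) / 2)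
      have := norm_sub_le (ftNS z - 24) ((fNS z + ftNS z) / 2 - ex z (-1))
      rw [← e] at *
      have : ‖(24:ℂ)‖ = 24 := by simp
      linarith
    have hp := prod_ABR hz0
    have e : (fNS z - ftNS z) / 2 = (fR z - 24) / 2 := by linear_combination (-1/2) * h.ident z hz0
    rw [e]
    have hn := congrArg norm hp
    rw [norm_mul, norm_mul] at hn
    have h12 : ‖(2:ℂ) ^ 12‖ = 4096 := by rw [norm_pow]; norm_num
    rw [h12] at hn
    rw [norm_div, le_div_iff₀ (by linarith)]
    have : ‖(2:ℂ)‖ = 2 := by simp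
    rw [this]
    have hAB : y ≤ ‖fNS z + 24‖ * ‖ftNS z - 24‖ := by nlinarith
    have := mul_le_mul_of_nonneg_right hAB (norm_nonneg (fR z - 24))
    linarith
  refine squeeze_zero' (Filter.Eventually.of_forall fun y => norm_nonneg _)
    (Filter.eventually_atTop.2 ⟨_, key⟩) ?_
  exact Filter.Tendsto.div_atTop tendsto_const_nhds Filter.tendsto_id

end CD

noncomputable def HH (a b : ZMod 2) (z : ℂ) : ℂ :=
  if a = 0 then (if b = 0 then 0 else ftNS z) else (if b = 0 then fR z else - fNS z)

noncomputable def mob (M : Matrix (Fin 2) (Fin 2) ℤ) (z : ℂ) : ℂ :=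
  ((M 0 0 : ℂ) * z + (M 0 1 : ℂ)) / ((M 1 0 : ℂ) * z + (M 1 1 : ℂ))

lemma mob_den (M : Matrix (Fin 2) (Fin 2) ℤ) (hM : 0 < M.det) {z : ℂ} (hz : 0 < z.im) :
    (M 1 0 : ℂ) * z + (M 1 1 : ℂ) ≠ 0 := by
  intro h
  have him := congrArg Complex.im h
  have hre := congrArg Complex.re h
  simp at him hre
  rw [Matrix.det_fin_two] at hM
  rcases him with h1 | h1
  · rw [h1] at hre hM
    simp at hre
    rw [hre] at hM; simp at hM
  · linarith

lemma mob_im (M : Matrix (Fin 2) (Fin 2) ℤ) (hM : 0 < M.det) {z : ℂ} (hz : 0 < z.im) :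
    (mob M z).im = M.det * z.im / ‖(M 1 0 : ℂ) * z + (M 1 1 : ℂ)‖ ^ 2 := by
  have h := mob_den M hM hz
  rw [mob, Complex.div_im, Matrix.det_fin_two, ← Complex.normSq_eq_norm_sq]
  have h' := (Complex.normSq_pos.2 h).ne'
  field_simp
  simp
  ring

lemma mob_pos (M : Matrix (Fin 2) (Fin 2) ℤ) (hM : 0 < M.det) {z : ℂ} (hz : 0 < z.im) :
    0 < (mob M z).im := by
  rw [mob_im M hM hz]
  have : 0 < ‖(M 1 0 : ℂ) * z + (M 1 1 : ℂ)‖ := norm_pos_iff.2 (mob_den M hM hz)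
  have : (0:ℝ) < M.det := by exact_mod_cast hM
  positivity

lemma dvh (a b u D : ℂ) (h : D ≠ 0) : a * (u / D) + b = (a * u + b * D) / D := by
  field_simp

lemma mob_mul (M N : Matrix (Fin 2) (Fin 2) ℤ) (hN : 0 < N.det) {z : ℂ}
    (hz : 0 < z.im) : mob (M * N) z = mob M (mob N z) := by
  have h1 := mob_den N hN hz
  rw [mob, mob, mob, Matrix.mul_apply, Matrix.mul_apply, Matrix.mul_apply, Matrix.mul_apply]
  simp only [Fin.sum_univ_two]
  push_cast
  rw [show ((M 0 0 : ℂ) * (((N 0 0 : ℂ) * z + (N 0 1 : ℂ)) / ((N 1 0 : ℂ) * z + (N 1 1 : ℂ))) + (M 0 1 : ℂ))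
     = ((M 0 0 : ℂ) * ((N 0 0 : ℂ) * z + (N 0 1 : ℂ)) + (M 0 1 : ℂ) * ((N 1 0 : ℂ) * z + (N 1 1 : ℂ))) / ((N 1 0 : ℂ) * z + (N 1 1 : ℂ)) from dvh _ _ _ _ h1,
    show ((M 1 0 : ℂ) * (((N 0 0 : ℂ) * z + (N 0 1 : ℂ)) / ((N 1 0 : ℂ) * z + (N 1 1 : ℂ))) + (M 1 1 : ℂ))
     = ((M 1 0 : ℂ) * ((N 0 0 : ℂ) * z + (N 0 1 : ℂ)) + (M 1 1 : ℂ) * ((N 1 0 : ℂ) * z + (N 1 1 : ℂ))) / ((N 1 0 : ℂ) * z + (N 1 1 : ℂ)) from dvh _ _ _ _ h1,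
    div_div_div_cancel_right₀ h1]
  congr 1 <;> ring

/-- `Φ M v z = H_{Mv}(Mz)` -/
noncomputable def Phi (M : Matrix (Fin 2) (Fin 2) ℤ) (v0 v1 : ZMod 2) (z : ℂ) : ℂ :=
  HH (M 0 0 * v0 + M 0 1 * v1) (M 1 0 * v0 + M 1 1 * v1) (mob M z)

lemma Phi_mul (M N : Matrix (Fin 2) (Fin 2) ℤ) (hN : 0 < N.det) (v0 v1 : ZMod 2) {z : ℂ}
    (hz : 0 < z.im) : Phi (M * N) v0 v1 z =
      Phi M (N 0 0 * v0 + N 0 1 * v1) (N 1 0 * v0 + N 1 1 * v1) (mob N z) := by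
  rw [Phi, Phi, mob_mul M N hN hz]
  simp only [Matrix.mul_apply, Fin.sum_univ_two]
  push_cast
  congr 1 <;> ring

lemma zm2 (a : ZMod 2) : a = 0 ∨ a = 1 := by revert a; decide

open ModularGroup in
lemma CD.Phi_SL {c : ZMod 2 → ZMod 2 → ℤ → ℤ} (h : CD c) (γ : Matrix.SpecialLinearGroup (Fin 2) ℤ)
    (v0 v1 : ZMod 2) {z : ℂ} (hz : 0 < z.im) : Phi γ.1 v0 v1 z = HH v0 v1 z := by
  have hγ : γ ∈ Subgroup.closure ({S, T} : Set (Matrix.SpecialLinearGroup (Fin 2) ℤ)) := by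
    rw [SpecialLinearGroup.SL2Z_generators]; trivial
  have dp : ∀ g : Matrix.SpecialLinearGroup (Fin 2) ℤ, 0 < g.1.det := fun g => by rw [g.2]; norm_num
  induction hγ using Subgroup.closure_induction generalizing v0 v1 z with
  | mem g hg =>
    rcases hg with rfl | hg
    · have : mob S.1 z = -1 / z := by simp [mob, S]
      rw [Phi, this]
      simp only [S, Matrix.of_apply, Matrix.cons_val_zero, Matrix.cons_val_one]
      rcases zm2 v0 with rfl | rfl <;> rcases zm2 v1 with rfl | rfl <;>
        simp [HH, ft_S hz, fR_S hz, fNS_S hz]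
    · rw [Set.mem_singleton_iff] at hg
      subst hg
      have : mob T.1 z = z + 1 := by simp [mob, T]
      rw [Phi, this]
      have e : (1 + 1 : ZMod 2) = 0 := by decide
      simp only [T, Matrix.of_apply, Matrix.cons_val_zero, Matrix.cons_val_one]
      rcases zm2 v0 with rfl | rfl <;> rcases zm2 v1 with rfl | rfl <;>
        simp [HH, h.ft_T hz, h.R_T hz, h.NS_T hz, e]
  | one => simp [Phi, mob]
  | mul x y _ _ hx hy =>
    rw [show (x * y).1 = x.1 * y.1 from rfl, Phi_mul _ _ (dp y) _ _ hz, hx _ _ (mob_pos _ (dp y) hz)]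
    exact hy _ _ hz
  | inv x _ hx =>
    have e := hx ((x⁻¹).1 0 0 * v0 + (x⁻¹).1 0 1 * v1) ((x⁻¹).1 1 0 * v0 + (x⁻¹).1 1 1 * v1)
      (mob_pos _ (dp x⁻¹) hz)
    rw [Phi, ← e, ← Phi_mul _ _ (dp x⁻¹) _ _ hz, ← show (x * x⁻¹).1 = x.1 * (x⁻¹).1 from rfl]
    simp [Phi, mob]

lemma CD.Phi_left {c : ZMod 2 → ZMod 2 → ℤ → ℤ} (h : CD c) (γ : Matrix.SpecialLinearGroup (Fin 2) ℤ)
    (M : Matrix (Fin 2) (Fin 2) ℤ) (hM : 0 < M.det)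
    (v0 v1 : ZMod 2) {z : ℂ} (hz : 0 < z.im) : Phi (γ.1 * M) v0 v1 z = Phi M v0 v1 z := by
  rw [Phi_mul _ _ hM _ _ hz, h.Phi_SL _ _ _ (mob_pos _ hM hz), Phi]

/-! growth -/

lemma CD.HH_bd {c : ZMod 2 → ZMod 2 → ℤ → ℤ} (h : CD c) : ∃ K : ℝ, 0 ≤ K ∧
    ∀ (v0 v1 : ZMod 2) (z : ℂ), 1 / 2 ≤ z.im → ‖HH v0 v1 z‖ ≤ K * Real.exp (π * z.im) := by
  have hh : ∀ (a : ℤ → ℤ) (f : ℂ → ℂ), (∀ m < -1, a m = 0) →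
     (∀ z : ℂ, 0 < z.im → HasSum (fun m => (a m : ℂ) * ex z m) (f z)) →
     ∃ K : ℝ, 0 ≤ K ∧ ∀ z : ℂ, 1 / 2 ≤ z.im → ‖f z‖ ≤ K * Real.exp (π * z.im) := by
    intro a f ha hf
    obtain ⟨M, hM, hb⟩ := bnd (fun m => (a m : ℂ)) (-1) (fun m hm => by simp [ha m hm]) (1/2)
      (summable_norm_of_hasSum _ (1/2) _ (hf _ (by simp)))
    refine ⟨M, hM, fun z hz => (hb z _ hz (hf z (by linarith))).trans ?_⟩
    gcongr ?_ * ?_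
    apply Real.exp_le_exp.2
    push_cast
    nlinarith [Real.pi_pos]
  obtain ⟨K1, p1, b1⟩ := hh _ ftNS (fun m hm => by
    rw [h.h11 m (Or.inl hm), h.h00 m (Or.inl (by omega))]; simp) (fun z hz => h.sft hz)
  obtain ⟨K2, p2, b2⟩ := hh _ fNS (fun m hm => by
    rw [h.h11 m (Or.inl hm), h.h00 m (Or.inl (by omega))]; simp) (fun z hz => h.sNS hz)
  obtain ⟨K3, p3, b3⟩ := hh _ _ (fun m hm => by
    rw [h.h01 m (Or.inl (by omega))]) (fun z hz => h.s01 hz)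
  refine ⟨K1 + K2 + (2 * K3 + 24), by positivity, fun v0 v1 z hz => ?_⟩
  have e1 := b1 z hz
  have e2 := b2 z hz
  have e3 : ‖fR z‖ ≤ (2 * K3 + 24) * Real.exp (π * z.im) := by
    rw [show fR z = (-2) * (-(fR z + 24) / 2) - 24 by ring]
    refine (norm_sub_le _ _).trans ?_
    rw [norm_mul, norm_neg, Complex.norm_ofNat, Complex.norm_ofNat]
    have := b3 z hz
    have : 1 ≤ Real.exp (π * z.im) := Real.one_le_exp (by have := Real.pi_pos; positivity)
    linarith
  have q1 : 0 ≤ K1 * Real.exp (π * z.im) := by positivity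
  have q2 : 0 ≤ K2 * Real.exp (π * z.im) := by positivity
  have q3 : 0 ≤ (2 * K3 + 24) * Real.exp (π * z.im) := by positivity
  rw [add_mul, add_mul]
  unfold HH
  split_ifs
  · simp; linarith
  · linarith
  · linarith
  · rw [norm_neg]; linarith

open UpperHalfPlane in
lemma CD.HH_bd' {c : ZMod 2 → ZMod 2 → ℤ → ℤ} (h : CD c) : ∃ K : ℝ, 0 ≤ K ∧
    ∀ (v0 v1 : ZMod 2) (z : ℂ), 0 < z.im → z.im ≤ 1 → ‖HH v0 v1 z‖ ≤ K * Real.exp (π / z.im) := by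
  obtain ⟨K, hK, hb⟩ := h.HH_bd
  refine ⟨K, hK, fun v0 v1 z hz hz1 => ?_⟩
  obtain ⟨γ, h1, -⟩ := ModularGroup.exists_one_half_le_im_smul_and_norm_denom_le ⟨z, hz⟩
  have hd : 0 < γ.1.det := by rw [γ.2]; norm_num
  have e : ((γ • (⟨z, hz⟩ : ℍ) : ℍ) : ℂ) = mob γ.1 z := by
    rw [UpperHalfPlane.specialLinearGroup_apply]; simp [mob]
  have e' : (γ • (⟨z, hz⟩ : ℍ) : ℍ).im = (mob γ.1 z).im := by rw [← e]; rfl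
  rw [e'] at h1
  rw [← h.Phi_SL γ v0 v1 hz, Phi]
  refine (hb _ _ _ h1).trans ?_
  have hden := mob_den γ.1 hd hz
  have hle : (mob γ.1 z).im ≤ 1 / z.im := by
    rw [mob_im _ hd hz, γ.2, ← Complex.normSq_eq_norm_sq,
      div_le_div_iff₀ (Complex.normSq_pos.2 hden) hz, Complex.normSq_apply]
    simp only [Complex.add_re, Complex.mul_re, Complex.intCast_re, Complex.intCast_im, zero_mul,
      sub_zero, Complex.add_im, Complex.mul_im, add_zero]
    push_cast
    by_cases h0 : γ.1 1 0 = 0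
    · have hdd := γ.2
      rw [Matrix.det_fin_two, h0] at hdd
      have h2 : γ.1 1 1 ≠ 0 := by intro h3; rw [h3] at hdd; simp at hdd
      have : 1 ≤ (γ.1 1 1) ^ 2 := by have := sq_pos_of_ne_zero h2; linarith
      have : (1:ℝ) ≤ (γ.1 1 1 : ℝ) ^ 2 := by exact_mod_cast this
      rw [h0]
      push_cast
      nlinarith
    · have : 1 ≤ (γ.1 1 0) ^ 2 := by have := sq_pos_of_ne_zero h0; linarith
      have : (1:ℝ) ≤ (γ.1 1 0 : ℝ) ^ 2 := by exact_mod_cast this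
      have h4 := mul_le_mul_of_nonneg_right this (mul_pos hz hz).le
      nlinarith [sq_nonneg ((γ.1 1 0 : ℝ) * z.re + γ.1 1 1)]
  gcongr
  rw [div_eq_mul_one_div]
  gcongr

lemma cauchy (a : ℤ → ℂ) (f : ℂ → ℂ) (t K : ℝ)
    (hf : ∀ x : ℝ, HasSum (fun m => a m * ex (x + t * Complex.I) m) (f (x + t * Complex.I)))
    (hK : ∀ x : ℝ, ‖f (x + t * Complex.I)‖ ≤ K) (m : ℤ) : ‖a m‖ ≤ K * Real.exp (π * t * m) := by
  have hex : ∀ (x : ℝ) (k : ℤ), ex (x + t * Complex.I) k * ex (x + t * Complex.I) (-m)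
      = ex (t * Complex.I) (k - m) * Complex.exp (π * Complex.I * ((k - m : ℤ) : ℂ) * x) := by
    intro x k
    simp only [ex, ← Complex.exp_add]
    congr 1; push_cast; ring
  have hs : Summable fun k : ℤ => ‖a k * ex (t * Complex.I) (k - m)‖ := by
    have := ((hf 0).summable.mul_right (ex (((0:ℝ):ℂ) + t * Complex.I) (-m))).norm
    refine this.congr fun k => ?_
    rw [mul_assoc, hex]; simp
  have key := intervalIntegral.hasSum_integral_of_dominated_convergence (a := 0) (b := 2)
    (μ := MeasureTheory.volume)
    (F := fun (k : ℤ) (x : ℝ) => a k * ex (t * Complex.I) (k - m) *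
      Complex.exp (π * Complex.I * ((k - m : ℤ) : ℂ) * x))
    (f := fun x => f (x + t * Complex.I) * ex (x + t * Complex.I) (-m))
    (bound := fun k _ => ‖a k * ex (t * Complex.I) (k - m)‖)
    (fun k => Continuous.aestronglyMeasurable (by fun_prop))
    (fun k => Filter.Eventually.of_forall fun x _ => by
      rw [norm_mul _ (Complex.exp _), Complex.norm_exp]; simp)
    (Filter.Eventually.of_forall fun x _ => hs)
    (by simp)
    (Filter.Eventually.of_forall fun x _ => by
      refine hsc ((hf x).mul_right (ex (x + t * Complex.I) (-m))) (fun k => ?_) rfl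
      rw [mul_assoc (a k), mul_assoc (a k), hex])
  have h2 : HasSum (fun k : ℤ => if k = m then 2 * a m else 0) (2 * a m) := hasSum_ite_eq m _
  have h3 := key.unique (hsc h2 (fun k => by
    rw [intervalIntegral.integral_const_mul]
    split_ifs with hk
    · subst hk; simp [ex]; ring
    · have hne : (π * Complex.I * ((k - m : ℤ) : ℂ)) ≠ 0 := by
        have : (π:ℂ) ≠ 0 := by exact_mod_cast Real.pi_ne_zero
        have h5 : ((k - m : ℤ) : ℂ) ≠ 0 := by exact_mod_cast sub_ne_zero.2 hk
        exact mul_ne_zero (mul_ne_zero this Complex.I_ne_zero) h5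
      rw [integral_exp_mul_complex hne]
      have : Complex.exp (π * Complex.I * ((k - m : ℤ) : ℂ) * ((2:ℝ):ℂ)) = 1 := by
        rw [Complex.exp_eq_one_iff]; exact ⟨k - m, by push_cast; ring⟩
      rw [this]; simp) rfl)
  have h4 : ‖2 * a m‖ ≤ K * Real.exp (π * t * m) * |2 - 0| := by
    rw [← h3]
    apply intervalIntegral.norm_integral_le_of_norm_le_const
    intro x _
    rw [norm_mul, norm_ex]
    have e : -π * (↑x + ↑t * Complex.I).im * ((-m : ℤ) : ℝ) = π * t * m := by simp
    rw [e]
    gcongr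
    exact hK x
  rw [norm_mul, Complex.norm_ofNat] at h4
  norm_num at h4
  linarith

/-- coefficient growth -/
lemma CD.growth {c : ZMod 2 → ZMod 2 → ℤ → ℤ} (h : CD c) : ∃ K : ℝ, 0 ≤ K ∧
    ∀ (i j : ZMod 2) (m : ℤ), 1 ≤ m → ‖(c i j m : ℂ)‖ ≤ K * Real.exp (2 * π * Real.sqrt m) := by
  obtain ⟨K, hK, hb⟩ := h.HH_bd'
  refine ⟨K + 12, by positivity, fun i j m hm => ?_⟩
  have hm1 : (1:ℝ) ≤ m := by exact_mod_cast hm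
  set s := Real.sqrt m with hs
  have hs1 : 1 ≤ s := Real.one_le_sqrt.2 hm1
  have hss : s * s = m := Real.mul_self_sqrt (by linarith)
  have him : ∀ x : ℝ, ((x:ℂ) + ((1 / s : ℝ):ℂ) * Complex.I).im = 1 / s := by intro x; simp
  have hpos : 0 < 1 / s := by positivity
  have h1s : 1 / s ≤ 1 := by rw [div_le_one (by positivity)]; exact hs1
  have := cauchy (fun m => (c i j m : ℂ)) (Fcomp i j) (1 / s) ((K + 12) * Real.exp (π * s))
    (fun x => h.hexp i j _ (by rw [him]; exact hpos)) ?_ m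
  · refine this.trans (le_of_eq ?_)
    rw [mul_assoc, ← Real.exp_add]
    congr 2
    rw [← hss]; field_simp; ring
  · intro x
    set z : ℂ := (x:ℂ) + ((1 / s : ℝ):ℂ) * Complex.I with hzdef
    have hz : 0 < z.im := by rw [him]; exact hpos
    have hz1 : z.im ≤ 1 := by rw [him]; exact h1s
    have ee : π / z.im = π * s := by rw [him]; field_simp
    have e1 := hb 0 1 z hz hz1
    have e2 := hb 1 1 z hz hz1
    have e3 := hb 1 0 z hz hz1
    rw [ee] at e1 e2 e3
    simp only [HH, if_true, one_ne_zero, if_false, norm_neg] at e1 e2 e3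
    have : 1 ≤ Real.exp (π * s) := Real.one_le_exp (by have := Real.pi_pos; positivity)
    have q1 : ‖(fNS z - ftNS z) / 2‖ ≤ (‖fNS z‖ + ‖ftNS z‖) / 2 := by
      rw [norm_div, Complex.norm_ofNat]; gcongr; exact norm_sub_le _ _
    have q2 : ‖(ftNS z - fNS z) / 2‖ ≤ (‖ftNS z‖ + ‖fNS z‖) / 2 := by
      rw [norm_div, Complex.norm_ofNat]; gcongr; exact norm_sub_le _ _
    have q3 : ‖(fNS z + ftNS z) / 2‖ ≤ (‖fNS z‖ + ‖ftNS z‖) / 2 := by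
      rw [norm_div, Complex.norm_ofNat]; gcongr; exact norm_add_le _ _
    have q4 : ‖-(fR z + 24) / 2‖ ≤ (‖fR z‖ + 24) / 2 := by
      rw [norm_div, Complex.norm_ofNat, norm_neg]; gcongr
      refine (norm_add_le _ _).trans ?_
      rw [Complex.norm_ofNat]
    rw [add_mul]
    unfold Fcomp
    split_ifs <;> nlinarith

open FixedDetMatrices in
lemma reps_exists {m : ℤ} (hm : m ≠ 0) (A : FixedDetMatrix (Fin 2) ℤ m) :
    ∃ γ : Matrix.SpecialLinearGroup (Fin 2) ℤ, γ • A ∈ reps m := by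
  induction A using (induction_on hm) with
  | h0 A a b c d => exact ⟨1, by rw [one_smul]; exact ⟨a, b, c, d⟩⟩
  | hS B hB =>
    obtain ⟨γ, h⟩ := hB
    exact ⟨γ * ModularGroup.S⁻¹, by rwa [mul_smul, inv_smul_smul]⟩
  | hT B hB =>
    obtain ⟨γ, h⟩ := hB
    exact ⟨γ * ModularGroup.T⁻¹, by rwa [mul_smul, inv_smul_smul]⟩

open FixedDetMatrices in
lemma reps_unique {m : ℤ} (A B : FixedDetMatrix (Fin 2) ℤ m) (hA : A ∈ reps m)
    (hB : B ∈ reps m) (γ : Matrix.SpecialLinearGroup (Fin 2) ℤ) (h : γ • A = B) : A = B := by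
  obtain ⟨a1, a2, a3, a4⟩ := hA
  obtain ⟨b1, b2, b3, b4⟩ := hB
  have hc : ∀ i j, B.1 i j = γ.1 i 0 * A.1 0 j + γ.1 i 1 * A.1 1 j := by
    intro i j
    rw [← h, smul_coe, Matrix.mul_apply, Fin.sum_univ_two]
  have e00 := hc 0 0
  have e01 := hc 0 1
  have e10 := hc 1 0
  have e11 := hc 1 1
  have hdet := γ.2
  rw [Matrix.det_fin_two] at hdet
  rw [a1] at e00 e10
  rw [b1] at e10
  have g10 : γ.1 1 0 = 0 := by
    simp at e10
    rcases e10 with h | h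
    · exact h
    · omega
  rw [g10] at hdet e11
  simp at hdet e11 e00
  have g00 : γ.1 0 0 = 1 := by
    rcases Int.eq_one_or_neg_one_of_mul_eq_one hdet with h | h
    · exact h
    · rw [h] at e00; omega
  rw [g00] at hdet e00 e01
  simp at hdet e00 e01
  rw [hdet] at e11
  simp at e11
  have g01 : γ.1 0 1 = 0 := by
    rw [e11] at b4
    rw [abs_of_nonneg a3] at a4
    rw [abs_of_nonneg b3] at b4
    have hd : A.1 0 1 - B.1 0 1 = - (γ.1 0 1) * A.1 1 1 := by rw [e01]; ring
    have h1 : |γ.1 0 1| * |A.1 1 1| < |A.1 1 1| := by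
      rw [← abs_mul, ← abs_neg, ← neg_mul, ← hd, abs_lt]
      constructor <;> linarith
    have h2 : |γ.1 0 1| < 1 := by
      by_contra hh
      push Not at hh
      nlinarith [abs_nonneg (A.1 1 1)]
    exact Int.abs_lt_one_iff.1 h2
  rw [g01] at e01
  simp at e01
  ext i j
  fin_cases i <;> fin_cases j
  · exact e00.symm
  · exact e01.symm
  · exact a1.trans b1.symm
  · exact e11.symm

open FixedDetMatrices in
noncomputable def Ghat (n : ℕ) (v0 v1 : ZMod 2) (z : ℂ) : ℂ :=
  ∑ M : reps (n : ℤ), Phi M.1.1 v0 v1 z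

open FixedDetMatrices in
lemma CD.Ghat_inv {c : ZMod 2 → ZMod 2 → ℤ → ℤ} (h : CD c) (n : ℕ) (hn : 0 < n)
    (γ : Matrix.SpecialLinearGroup (Fin 2) ℤ) (v0 v1 : ZMod 2) {z : ℂ} (hz : 0 < z.im) :
    Ghat n (γ.1 0 0 * v0 + γ.1 0 1 * v1) (γ.1 1 0 * v0 + γ.1 1 1 * v1) (mob γ.1 z) = Ghat n v0 v1 z := by
  have hn' : (n:ℤ) ≠ 0 := by exact_mod_cast hn.ne'
  have hnp : (0:ℤ) < n := by exact_mod_cast hn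
  have hγ : 0 < γ.1.det := by rw [γ.2]; norm_num
  let R : FixedDetMatrix (Fin 2) ℤ n → FixedDetMatrix (Fin 2) ℤ n := fun A =>
    ⟨A.1 * γ.1, by rw [Matrix.det_mul, A.2, γ.2, mul_one]⟩
  choose g hg using fun A => reps_exists hn' (R A)
  let φ : reps (n:ℤ) → reps (n:ℤ) := fun A => ⟨g A.1 • R A.1, hg A.1⟩
  have hinj : Function.Injective φ := by
    intro A B hAB
    have h1 : g A.1 • R A.1 = g B.1 • R B.1 := congrArg Subtype.val hAB
    have h2 : ((g B.1)⁻¹ * g A.1) • R A.1 = R B.1 := by rw [mul_smul, h1, inv_smul_smul]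
    apply Subtype.ext
    refine reps_unique _ _ A.2 B.2 ((g B.1)⁻¹ * g A.1) ?_
    apply ext'
    have h3 := congrArg Subtype.val h2
    rw [smul_coe] at h3 ⊢
    simp only [R] at h3
    rw [← mul_assoc] at h3
    have h4 := congrArg (fun X => X * (γ⁻¹).1) h3
    simp only [mul_assoc, ← show (γ * γ⁻¹).1 = γ.1 * (γ⁻¹).1 from rfl] at h4
    simpa [mul_assoc] using h4
  have hbij := Finite.injective_iff_bijective.1 hinj
  rw [Ghat, Ghat]
  refine Fintype.sum_bijective φ hbij _ _ fun A => ?_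
  rw [← Phi_mul _ _ hγ _ _ hz]
  have e : (φ A).1.1 = (g A.1).1 * (A.1.1 * γ.1) := rfl
  rw [e, h.Phi_left _ _ _ _ _ hz]
  rw [Matrix.det_mul, A.1.2, γ.2, mul_one]; exact hnp

open FixedDetMatrices in
lemma Ghat_eq (n : ℕ) (hn : 0 < n) (v0 v1 : ZMod 2) (z : ℂ) :
    Ghat n v0 v1 z = ∑ x ∈ n.divisorsAntidiagonal, ∑ s ∈ Finset.range x.2,
      HH (x.1 * v0 + s * v1) (x.2 * v1) ((x.1 * z + s) / x.2) := by
  rw [Finset.sum_sigma', Ghat]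
  symm
  refine Finset.sum_bij (fun x hx => ⟨⟨!![(x.1.1 : ℤ), (x.2 : ℤ); 0, (x.1.2 : ℤ)], ?_⟩, ?_⟩)
    (fun _ _ => Finset.mem_univ _) ?_ ?_ ?_
  · rw [Finset.mem_sigma, Nat.mem_divisorsAntidiagonal] at hx
    rw [Matrix.det_fin_two]; simp
    exact_mod_cast hx.1.1
  · rw [Finset.mem_sigma, Nat.mem_divisorsAntidiagonal, Finset.mem_range] at hx
    have : 0 < x.1.1 := Nat.pos_of_ne_zero (by intro h; rw [h] at hx; simp at hx; omega)
    refine ⟨by simp, by simpa using this, by simp, ?_⟩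
    simp
    exact hx.2
  · rintro ⟨⟨a, b⟩, s⟩ _ ⟨⟨a', b'⟩, s'⟩ _ h
    have h' := congrArg (fun X => X.1.1) h
    have e00 := congrFun (congrFun h' 0) 0
    have e01 := congrFun (congrFun h' 0) 1
    have e11 := congrFun (congrFun h' 1) 1
    simp at e00 e01 e11
    subst e00 e01 e11
    rfl
  · rintro ⟨A, hA⟩ _
    obtain ⟨a1, a2, a3, a4⟩ := hA
    have hd := A.2
    rw [Matrix.det_fin_two, a1] at hd
    simp at hd
    have hnp : (0:ℤ) < n := by exact_mod_cast hn
    have a5 : 0 < A.1 1 1 := by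
      rw [← hd] at hnp
      exact pos_of_mul_pos_right hnp a2.le
    rw [abs_of_nonneg a3, abs_of_pos a5] at a4
    refine ⟨⟨⟨(A.1 0 0).toNat, (A.1 1 1).toNat⟩, (A.1 0 1).toNat⟩, ?_, ?_⟩
    · rw [Finset.mem_sigma, Nat.mem_divisorsAntidiagonal, Finset.mem_range]
      refine ⟨⟨?_, hn.ne'⟩, ?_⟩
      · zify
        rw [Int.toNat_of_nonneg a2.le, Int.toNat_of_nonneg a5.le, hd]
      · change (A.1 0 1).toNat < (A.1 1 1).toNat
        omega
    · apply Subtype.ext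
      ext i j
      fin_cases i <;> fin_cases j
      · simpa using a2.le
      · simpa using a3
      · simpa using a1.symm
      · simpa using a5.le
  · rintro ⟨⟨a, b⟩, s⟩ _
    simp [Phi, mob]

lemma sum_pow_root (x : ℂ) (d : ℕ) (hx : x ^ d = 1) :
    ∑ s ∈ Finset.range d, x ^ s = if x = 1 then (d:ℂ) else 0 := by
  split_ifs with h
  · simp [h]
  · rw [geom_sum_eq h, hx]; simp

/-- exponents -/
def ee (c : ZMod 2 → ZMod 2 → ℤ → ℤ) (d : ℕ) (r : ℤ) : ℤ := c (d : ZMod 2) (r : ZMod 2) (r * d)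

lemma zc_even {n : ℕ} (h : Even n) : (n : ZMod 2) = 0 := (ZMod.natCast_eq_zero_iff_even).2 h
lemma zc_odd {n : ℕ} (h : Odd n) : (n : ZMod 2) = 1 := (ZMod.natCast_eq_one_iff_odd).2 h
lemma zi_even {n : ℤ} (h : Even n) : (n : ZMod 2) = 0 := by
  obtain ⟨k, rfl⟩ := h
  push_cast
  exact CharTwo.add_self_eq_zero _
lemma zi_odd {n : ℤ} (h : Odd n) : (n : ZMod 2) = 1 := by
  obtain ⟨k, rfl⟩ := h
  push_cast
  rw [show (2 : ZMod 2) = 0 by decide]; simp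

lemma CD.ee_odd {c : ZMod 2 → ZMod 2 → ℤ → ℤ} (h : CD c) {d : ℕ} (hd : Odd d) (r : ℤ) :
    ee c d r = c 1 1 (r * d) - c 0 0 (r * d) := by
  rw [ee, zc_odd hd]
  have hd' : Odd (d:ℤ) := by exact_mod_cast hd
  rcases Int.even_or_odd r with hr | hr
  · rw [zi_even hr, h.h10, h.h11 _ (Or.inr (hr.mul_right _).two_dvd)]; simp
  · rw [zi_odd hr, h.h00 _ (Or.inr (by rw [← even_iff_two_dvd, Int.not_even_iff_odd]; exact hr.mul hd'))]; simp

lemma CD.ee_even {c : ZMod 2 → ZMod 2 → ℤ → ℤ} (h : CD c) {d : ℕ} (hd : Even d) (hd0 : 0 < d) (r : ℤ) :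
    ((ee c d r : ℤ) : ℂ) = (-1) ^ r * c 0 0 (r * d) := by
  rw [ee, zc_even hd]
  rcases Int.even_or_odd r with hr | hr
  · rw [zi_even hr, hr.neg_one_zpow]; simp
  · rw [zi_odd hr, hr.neg_one_zpow, h.c01]
    · push_cast; ring
    · have : r ≠ 0 := by rintro rfl; simp at hr
      have : (d:ℤ) ≠ 0 := by exact_mod_cast hd0.ne'
      positivity

lemma hasSum_dvd (d : ℕ) (hd : 0 < d) (f g : ℤ → ℂ) (S : ℂ) (h : HasSum f S)
    (h0 : ∀ m : ℤ, ¬ ((d:ℤ) ∣ m) → f m = 0) (h1 : ∀ r : ℤ, f (r * d) = g r) : HasSum g S := by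
  have hinj : Function.Injective (fun r : ℤ => r * d) := by
    intro a b hab
    have : (d:ℤ) ≠ 0 := by exact_mod_cast hd.ne'
    exact mul_right_cancel₀ this hab
  rw [← hinj.hasSum_iff (f := f)] at h
  · exact hsc h (fun r => (h1 r).symm) rfl
  · intro m hm
    apply h0
    rintro ⟨r, rfl⟩
    exact hm ⟨r, by simp [mul_comm]⟩

lemma im_lin (k d s : ℕ) (hd : 0 < d) (z : ℂ) : ((k * z + s) / d : ℂ).im = k * z.im / d := by
  have : ((k * z + s) / d : ℂ) = ((1 / d : ℝ) : ℂ) * (k * z + s) := by push_cast; field_simp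
  rw [this, Complex.im_ofReal_mul]
  simp
  ring

lemma im_lin_pos (k d s : ℕ) (hk : 0 < k) (hd : 0 < d) {z : ℂ} (hz : 0 < z.im) :
    0 < ((k * z + s) / d : ℂ).im := by
  rw [im_lin k d s hd]
  positivity

lemma CD.part_odd {c : ZMod 2 → ZMod 2 → ℤ → ℤ} (h : CD c) (k d : ℕ) (hk : 0 < k) (hd : Odd d)
    {z : ℂ} (hz : 0 < z.im) :
    HasSum (fun r : ℤ => d * (ee c d r : ℂ) * ex z (r * k))
      (∑ s ∈ Finset.range d, HH s d ((k * z + s) / d)) := by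
  have hd0 : 0 < d := hd.pos
  have hdc : (d:ℂ) ≠ 0 := by exact_mod_cast hd0.ne'
  have hH : ∀ s : ℕ, ∀ w : ℂ, 0 < w.im → HasSum (fun m : ℤ => ((c 1 1 m - c 0 0 m : ℤ) : ℂ) *
      (((-1) ^ m) ^ s * ex w m)) (HH s d w) := by
    intro s w hw
    rcases Nat.even_or_odd s with hs | hs
    · rw [HH, zc_even hs, zc_odd hd]
      simp only [if_true, one_ne_zero, if_false]
      refine hsc (h.sft hw) (fun m => ?_) rfl
      rw [← zpow_natCast, ← zpow_mul, Even.neg_one_zpow]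
      · simp
      · exact (by exact_mod_cast hs : Even (s:ℤ)).mul_left _
    · rw [HH, zc_odd hs, zc_odd hd]
      simp only [one_ne_zero, if_false]
      refine hsc (h.sNS hw).neg (fun m => ?_) rfl
      have : (((-1 : ℂ) ^ m) ^ s) = (-1) ^ m := by
        rw [← zpow_natCast, ← zpow_mul]
        rcases Int.even_or_odd m with hm | hm
        · rw [hm.neg_one_zpow, (hm.mul_right _).neg_one_zpow]
        · rw [hm.neg_one_zpow, Odd.neg_one_zpow]
          exact hm.mul (by exact_mod_cast hs)
      rw [this, ← mul_assoc, h.ft_sign]; ring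
  have hsum := hasSum_sum (s := Finset.range d) fun s _ => hH s _ (im_lin_pos k d s hk hd0 hz)
  have hx : ∀ m : ℤ, ∀ s : ℕ, (((-1 : ℂ) ^ m) ^ s * ex ((k * z + s) / d) m)
      = Complex.exp (π * Complex.I * (k * z * m / d)) * Complex.exp (π * Complex.I * m * (1 + d) / d) ^ s := by
    intro m s
    have : ((-1 : ℂ)) ^ m = Complex.exp (π * Complex.I * m) := by
      rw [← Complex.exp_pi_mul_I, ← Complex.exp_int_mul]; congr 1; ring
    rw [this, ex, ← Complex.exp_nat_mul, ← Complex.exp_nat_mul, ← Complex.exp_add, ← Complex.exp_add]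
    congr 1; field_simp; ring
  obtain ⟨j, hj⟩ := hd
  have hpi : (π:ℂ) ≠ 0 := by exact_mod_cast Real.pi_ne_zero
  have hroot : ∀ m : ℤ, Complex.exp (π * Complex.I * m * (1 + d) / d) ^ d = 1 := by
    intro m
    rw [← Complex.exp_nat_mul, Complex.exp_eq_one_iff]
    refine ⟨m * (j + 1), ?_⟩
    rw [hj] at hdc ⊢
    field_simp; push_cast; ring
  refine hasSum_dvd d hd0 _ _ _ hsum ?_ ?_
  · intro m hm
    simp only [hx, ← Finset.mul_sum]
    rw [sum_pow_root _ _ (hroot m), if_neg]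
    · simp
    · rw [Complex.exp_eq_one_iff]
      rintro ⟨n, hn⟩
      apply hm
      have : (m : ℂ) * (1 + d) = n * 2 * d := by
        field_simp at hn
        linear_combination hn
      have : m * (1 + d) = n * 2 * d := by exact_mod_cast this
      exact ⟨2 * n - m, by linear_combination this⟩
  · intro r
    simp only [hx, ← Finset.mul_sum]
    rw [sum_pow_root _ _ (hroot _), if_pos, h.ee_odd ⟨j, hj⟩, ex]
    · rw [show (π * Complex.I * (k * z * ((r * d : ℤ) : ℂ) / d) : ℂ) = π * Complex.I * z * ((r * k : ℤ) : ℂ) by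
        push_cast; field_simp]
      ring
    · rw [Complex.exp_eq_one_iff]
      refine ⟨r * (j + 1), ?_⟩
      push_cast
      rw [hj] at hdc ⊢
      field_simp; push_cast; ring

lemma CD.part_even {c : ZMod 2 → ZMod 2 → ℤ → ℤ} (h : CD c) (k d : ℕ) (hk : 0 < k) (hd0 : 0 < d) (hd : Even d)
    {z : ℂ} (hz : 0 < z.im) :
    HasSum (fun r : ℤ => d * (ee c d r : ℂ) * ex z (r * k))
      (∑ s ∈ Finset.range d, HH s d ((k * z + s) / d) - 12 * d) := by
  have hdc : (d:ℂ) ≠ 0 := by exact_mod_cast hd0.ne'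
  have hH : ∀ s : ℕ, ∀ w : ℂ, 0 < w.im → HasSum (fun m : ℤ => (c 0 0 m : ℂ) *
      ((1 - (-1) ^ s) * ex w m)) (HH s d w - 12 * (1 - (-1) ^ s)) := by
    intro s w hw
    rcases Nat.even_or_odd s with hs | hs
    · rw [HH, zc_even hs, zc_even hd, hs.neg_one_pow]
      simp only [if_true]
      simp
    · rw [HH, zc_odd hs, zc_even hd, hs.neg_one_pow]
      simp only [one_ne_zero, if_false, if_true]
      refine hsc ((h.s00 hw).mul_left 2) (fun m => by ring) ?_
      linear_combination h.ident w hw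
  have hsum := hasSum_sum (s := Finset.range d) fun s _ => hH s _ (im_lin_pos k d s hk hd0 hz)
  have hconst : ∑ s ∈ Finset.range d, (HH s d ((k * z + s) / d) - 12 * (1 - (-1) ^ s)) =
      (∑ s ∈ Finset.range d, HH s d ((k * z + s) / d) - 12 * d) := by
    rw [Finset.sum_sub_distrib, ← Finset.mul_sum, Finset.sum_sub_distrib,
      sum_pow_root _ _ hd.neg_one_pow, if_neg (by norm_num)]
    simp
  rw [hconst] at hsum
  have hx : ∀ m : ℤ, ∀ s : ℕ, ((1 - (-1 : ℂ) ^ s) * ex ((k * z + s) / d) m)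
      = Complex.exp (π * Complex.I * (k * z * m / d)) * (Complex.exp (π * Complex.I * m / d) ^ s
        - (- Complex.exp (π * Complex.I * m / d)) ^ s) := by
    intro m s
    rw [neg_pow (Complex.exp _), ← one_sub_mul, mul_left_comm]
    congr 1
    rw [ex, ← Complex.exp_nat_mul, ← Complex.exp_add]
    congr 1; field_simp
  have hpi : (π:ℂ) ≠ 0 := by exact_mod_cast Real.pi_ne_zero
  have hroot : ∀ m : ℤ, Even m → Complex.exp (π * Complex.I * m / d) ^ d = 1 := by
    rintro m ⟨j, rfl⟩
    rw [← Complex.exp_nat_mul, Complex.exp_eq_one_iff]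
    refine ⟨j, ?_⟩
    field_simp; push_cast; ring
  have hroot2 : ∀ m : ℤ, Even m → (-Complex.exp (π * Complex.I * m / d)) ^ d = 1 := by
    intro m hm
    rw [hd.neg_pow, hroot m hm]
  refine hasSum_dvd d hd0 _ _ _ hsum ?_ ?_
  · intro m hm
    rcases Int.even_or_odd m with hme | hmo
    · simp only [hx, ← Finset.mul_sum, Finset.sum_sub_distrib]
      have hsq : Complex.exp (π * Complex.I * m / d) ^ 2 ≠ 1 := by
        rw [← Complex.exp_nat_mul, ne_eq, Complex.exp_eq_one_iff]
        rintro ⟨n, hn⟩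
        apply hm
        have : (m : ℂ) = n * d := by
          push_cast at hn
          field_simp at hn
          linear_combination hn
        exact ⟨n, by rw [mul_comm]; exact_mod_cast this⟩
      rw [sum_pow_root _ _ (hroot m hme), sum_pow_root _ _ (hroot2 m hme), if_neg, if_neg]
      · simp
      · intro h1; apply hsq; rw [← neg_sq, h1]; simp
      · intro h1; apply hsq; rw [h1]; simp
    · simp [h.h00 m (Or.inr (by rw [← even_iff_two_dvd]; simpa using hmo))]
  · intro r
    have hde : Even ((r * d : ℤ)) := (by exact_mod_cast hd : Even (d:ℤ)).mul_left _
    simp only [hx, ← Finset.mul_sum, Finset.sum_sub_distrib]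
    rw [sum_pow_root _ _ (hroot _ hde), sum_pow_root _ _ (hroot2 _ hde), h.ee_even hd hd0, ex]
    rw [show (π * Complex.I * (k * z * ((r * d : ℤ) : ℂ) / d) : ℂ) = π * Complex.I * z * ((r * k : ℤ) : ℂ) by
        push_cast; field_simp]
    have e : Complex.exp (π * Complex.I * ((r * d : ℤ) : ℂ) / d) = (-1) ^ r := by
      rw [← Complex.exp_pi_mul_I, ← Complex.exp_int_mul]; congr 1; push_cast; field_simp
    rw [e]
    rcases Int.even_or_odd r with hr | hr
    · rw [hr.neg_one_zpow]; norm_num; ring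
    · rw [hr.neg_one_zpow]; norm_num; ring

noncomputable def rc (g : ℕ → ℂ) : ℕ → ℂ
  | 0 => 1
  | n + 1 => -(∑ i : Fin (n + 1), g (n - i + 1) * rc g i) / (n + 1)

lemma rc_zero (g : ℕ → ℂ) : rc g 0 = 1 := by rw [rc]

lemma rc_succ (g : ℕ → ℂ) (n : ℕ) :
    rc g (n + 1) = -(∑ x ∈ Finset.HasAntidiagonal.antidiagonal n, g (x.1 + 1) * rc g x.2) / (n + 1) := by
  rw [rc, ← Finset.Nat.sum_antidiagonal_swap, Finset.Nat.sum_antidiagonal_eq_sum_range_succ_mk,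
    ← Fin.sum_univ_eq_sum_range (fun i => g ((i, n - i).swap.1 + 1) * rc g (i, n - i).swap.2)]
  rfl

lemma rc_unique (g a : ℕ → ℂ) (h0 : a 0 = 1)
    (h : ∀ n : ℕ, ((n:ℂ) + 1) * a (n + 1) = -(∑ x ∈ Finset.HasAntidiagonal.antidiagonal n, g (x.1 + 1) * a x.2)) (n : ℕ) :
    a n = rc g n := by
  induction n using Nat.strong_induction_on with
  | _ n ih =>
    cases n with
    | zero => rw [h0, rc_zero]
    | succ n =>
      have hn : (n:ℂ) + 1 ≠ 0 := by exact_mod_cast Nat.succ_ne_zero n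
      rw [rc_succ, eq_div_iff hn, mul_comm, h]
      congr 1
      refine Finset.sum_congr rfl fun x hx => ?_
      rw [ih x.2 (by have := Finset.HasAntidiagonal.mem_antidiagonal.1 hx; omega)]

lemma rc_rec (g : ℕ → ℂ) (n : ℕ) :
    ((n:ℂ) + 1) * rc g (n + 1) = -(∑ x ∈ Finset.HasAntidiagonal.antidiagonal n, g (x.1 + 1) * rc g x.2) := by
  have hn : (n:ℂ) + 1 ≠ 0 := by exact_mod_cast Nat.succ_ne_zero n
  rw [rc_succ]; field_simp

lemma rc_congr (g g' : ℕ → ℂ) (h : ∀ n, 0 < n → g n = g' n) (n : ℕ) : rc g n = rc g' n := by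
  refine rc_unique g' _ (rc_zero g) (fun n => ?_) n
  rw [rc_rec]
  congr 1
  exact Finset.sum_congr rfl fun x _ => by rw [h _ (Nat.succ_pos _)]

lemma rc_diff (g : ℕ → ℂ → ℂ) (z : ℂ) (h : ∀ n, 0 < n → DifferentiableAt ℂ (g n) z) (n : ℕ) :
    DifferentiableAt ℂ (fun w => rc (fun k => g k w) n) z := by
  induction n using Nat.strong_induction_on with
  | _ n ih =>
    cases n with
    | zero => simp only [rc_zero]; fun_prop
    | succ n =>
      simp only [rc_succ]
      apply DifferentiableAt.div_const
      apply DifferentiableAt.neg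
      apply DifferentiableAt.fun_sum
      intro x hx
      exact (h _ (Nat.succ_pos _)).mul (ih x.2 (by have := Finset.HasAntidiagonal.mem_antidiagonal.1 hx; omega))

lemma rc_bound (C : ℕ → ℝ) (hC : ∀ n, 0 ≤ C n) (n : ℕ) : ∃ D : ℝ, 0 ≤ D ∧ ∀ (g : ℕ → ℂ) (ε : ℝ),
    0 ≤ ε → ε ≤ 1 → (∀ n, 0 < n → ‖g n‖ ≤ C n * ε) → ‖rc g n‖ ≤ D ∧ (0 < n → ‖rc g n‖ ≤ D * ε) := by
  induction n using Nat.strong_induction_on with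
  | _ n ih =>
    cases n with
    | zero => exact ⟨1, by norm_num, fun g ε _ _ _ => by simp [rc_zero]⟩
    | succ n =>
      have ih' : ∀ k : ℕ, ∃ D : ℝ, 0 ≤ D ∧ (k < n + 1 → ∀ (g : ℕ → ℂ) (ε : ℝ),
          0 ≤ ε → ε ≤ 1 → (∀ n, 0 < n → ‖g n‖ ≤ C n * ε) → ‖rc g k‖ ≤ D) := by
        intro k
        by_cases hk : k < n + 1
        · obtain ⟨D, hD, h⟩ := ih k hk
          exact ⟨D, hD, fun _ g ε a b c => (h g ε a b c).1⟩
        · exact ⟨0, le_rfl, fun h => absurd h hk⟩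
      choose D hD h using ih'
      refine ⟨∑ x ∈ Finset.HasAntidiagonal.antidiagonal n, C (x.1 + 1) * D x.2,
        Finset.sum_nonneg fun x _ => mul_nonneg (hC _) (hD _), ?_⟩
      intro g ε e0 e1 hg
      have key : ‖rc g (n + 1)‖ ≤ (∑ x ∈ Finset.HasAntidiagonal.antidiagonal n, C (x.1 + 1) * D x.2) * ε := by
        rw [rc_succ, norm_div, norm_neg]
        have hn : ‖(n:ℂ) + 1‖ = n + 1 := by
          have : (n:ℂ) + 1 = ((n + 1 : ℕ) : ℂ) := by push_cast; rfl
          rw [this, Complex.norm_natCast]; push_cast; rfl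
        rw [hn]
        refine (div_le_self (norm_nonneg _) (by have : (0:ℝ) ≤ n := Nat.cast_nonneg n
                                                linarith)).trans ?_
        rw [Finset.sum_mul]
        refine norm_sum_le_of_le _ fun x hx => ?_
        rw [norm_mul, mul_right_comm]
        gcongr
        · exact mul_nonneg (hC _) e0
        · exact hg _ (Nat.succ_pos _)
        · exact h x.2 (by have := Finset.HasAntidiagonal.mem_antidiagonal.1 hx; omega) g ε e0 e1 hg
      refine ⟨key.trans ?_, fun _ => key⟩
      exact mul_le_of_le_one_right (Finset.sum_nonneg fun x _ => mul_nonneg (hC _) (hD _)) e1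

lemma rc_ps (g : ℕ → ℂ) : PowerSeries.derivative ℂ (PowerSeries.mk (rc g)) =
    - (PowerSeries.mk (fun n => g (n + 1)) * PowerSeries.mk (rc g)) := by
  ext n
  rw [PowerSeries.coeff_derivative, map_neg, PowerSeries.coeff_mul]
  simp only [PowerSeries.coeff_mk]
  rw [mul_comm, rc_rec]

lemma rc_pole (g : ℕ → ℂ) (w : ℂ) (n : ℕ) :
    rc (fun n => g n + w ^ n) (n + 1) = rc g (n + 1) - w * rc g n := by
  set Q := PowerSeries.mk (rc g) with hQ
  set B := (1 - PowerSeries.C w * PowerSeries.X) * Q with hB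
  have hBc : ∀ n, PowerSeries.coeff (n + 1) B = rc g (n + 1) - w * rc g n := by
    intro n
    rw [hB, sub_mul, one_mul, map_sub, mul_assoc, PowerSeries.coeff_C_mul,
      PowerSeries.coeff_succ_X_mul, hQ, PowerSeries.coeff_mk, PowerSeries.coeff_mk]
  have hB0 : PowerSeries.coeff 0 B = 1 := by
    simp [hB, hQ, rc_zero]
  have hW : (1 - PowerSeries.C w * PowerSeries.X) * PowerSeries.mk (fun n => w ^ (n + 1))
      = PowerSeries.C w := by
    ext n
    rw [sub_mul, one_mul, map_sub, mul_assoc, PowerSeries.coeff_C_mul]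
    cases n with
    | zero => simp
    | succ n =>
      rw [PowerSeries.coeff_succ_X_mul, PowerSeries.coeff_mk, PowerSeries.coeff_mk,
        PowerSeries.coeff_C]
      simp; ring
  have hD : PowerSeries.derivative ℂ B = -(PowerSeries.mk (fun n => g (n + 1) + w ^ (n + 1)) * B) := by
    have e : PowerSeries.mk (fun n => g (n + 1) + w ^ (n + 1)) =
       PowerSeries.mk (fun n => g (n + 1)) + PowerSeries.mk (fun n => w ^ (n + 1)) := by
      ext n; simp
    have e2 : PowerSeries.derivative ℂ (1 - PowerSeries.C w * PowerSeries.X) = - PowerSeries.C w := by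
      ext n
      rw [PowerSeries.coeff_derivative]
      cases n with
      | zero => simp [PowerSeries.coeff_one]
      | succ n => simp [PowerSeries.coeff_one, PowerSeries.coeff_X, PowerSeries.coeff_C]
    rw [hB, Derivation.leibniz, smul_eq_mul, smul_eq_mul, rc_ps, e, e2]
    linear_combination (PowerSeries.mk (rc g)) * hW
  rw [← hBc]
  symm
  refine rc_unique _ (fun n => PowerSeries.coeff n B) hB0 (fun n => ?_) (n + 1)
  clear_value B
  have := congrArg (PowerSeries.coeff n) hD
  rw [PowerSeries.coeff_derivative, map_neg, PowerSeries.coeff_mul] at this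
  simp only [PowerSeries.coeff_mk] at this
  rw [mul_comm, this]

/-! the modular part -/

noncomputable def cst (n : ℕ) : ℂ :=
  ∑ x ∈ n.divisorsAntidiagonal, if Even x.2 then (12 * x.2 : ℂ) else 0

def ep (c : ZMod 2 → ZMod 2 → ℤ → ℤ) (d : ℕ) (r : ℤ) : ℤ := if r ≤ 0 then 0 else ee c d r

noncomputable def gp (c : ZMod 2 → ZMod 2 → ℤ → ℤ) (k d : ℕ) (z : ℂ) : ℂ :=
  ∑' r : ℤ, (d : ℂ) * (ep c d r : ℂ) * ex z (r * k)

noncomputable def gg (c : ZMod 2 → ZMod 2 → ℤ → ℤ) (n : ℕ) (z : ℂ) : ℂ :=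
  ∑ x ∈ n.divisorsAntidiagonal, gp c x.1 x.2 z

lemma CD.ee_nonpos {c : ZMod 2 → ZMod 2 → ℤ → ℤ} (h : CD c) (d : ℕ) (hd : 0 < d) (r : ℤ) (hr : r ≤ 0) :
    ee c d r = if d = 1 ∧ r = -1 then 1 else 0 := by
  have hd' : (0:ℤ) < d := by exact_mod_cast hd
  rcases Nat.even_or_odd d with hde | hdo
  · have hd1 : ¬ (d = 1 ∧ r = -1) := by rintro ⟨rfl, -⟩; simp at hde
    rw [if_neg hd1]
    have := h.ee_even hde hd r
    have h0 : c 0 0 (r * d) = 0 := by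
      rcases hr.lt_or_eq with h1 | h1
      · exact h.h00 _ (Or.inl (mul_neg_of_neg_of_pos h1 hd'))
      · rw [h1, zero_mul]; exact h.c000
    rw [h0] at this
    simpa using this
  · rw [h.ee_odd hdo]
    have h0 : c 0 0 (r * d) = 0 := by
      rcases hr.lt_or_eq with h1 | h1
      · exact h.h00 _ (Or.inl (mul_neg_of_neg_of_pos h1 hd'))
      · rw [h1, zero_mul]; exact h.c000
    rw [h0, sub_zero]
    split_ifs with h1
    · rw [h1.1, h1.2]; simpa using h.h11p
    · rcases hr.lt_or_eq with h2 | h2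
      · apply h.h11 _ (Or.inl _)
        by_contra h3
        apply h1
        have h5 : r * d ≤ -1 := by nlinarith
        have h4 : r * d = -1 := by omega
        have h6 : (d:ℤ) = 1 := by nlinarith
        constructor
        · exact_mod_cast h6
        · rw [h6] at h4; simpa using h4
      · rw [h2, zero_mul]; exact h.h11 _ (Or.inr (by simp))

lemma CD.part {c : ZMod 2 → ZMod 2 → ℤ → ℤ} (h : CD c) (k d : ℕ) (hk : 0 < k) (hd : 0 < d)
    {z : ℂ} (hz : 0 < z.im) :
    HasSum (fun r : ℤ => (d : ℂ) * (ep c d r : ℂ) * ex z (r * k))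
      (∑ s ∈ Finset.range d, HH s d ((k * z + s) / d) - (if Even d then (12 * d : ℂ) else 0)
        - if d = 1 then ex z (-k) else 0) := by
  have h1 : HasSum (fun r : ℤ => (d : ℂ) * (ee c d r : ℂ) * ex z (r * k))
      (∑ s ∈ Finset.range d, HH s d ((k * z + s) / d) - (if Even d then (12 * d : ℂ) else 0)) := by
    split_ifs with hde
    · exact h.part_even k d hk hd hde hz
    · rw [sub_zero]; exact h.part_odd k d hk (by simpa using hde) hz
  refine hsc (h1.sub (hasSum_ite_eq (-1 : ℤ) (if d = 1 then ex z (-k) else 0))) (fun r => ?_) rfl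
  rw [ep]
  split_ifs with a b c' d' <;> (try rw [h.ee_nonpos d hd r a]) <;> simp_all

lemma CD.gp_hasSum {c : ZMod 2 → ZMod 2 → ℤ → ℤ} (h : CD c) (k d : ℕ) (hk : 0 < k) (hd : 0 < d)
    {z : ℂ} (hz : 0 < z.im) :
    HasSum (fun r : ℤ => (d : ℂ) * (ep c d r : ℂ) * ex z (r * k)) (gp c k d z) :=
  (h.part k d hk hd hz).summable.hasSum

lemma CD.Ghat_gg {c : ZMod 2 → ZMod 2 → ℤ → ℤ} (h : CD c) (n : ℕ) (hn : 0 < n)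
    {z : ℂ} (hz : 0 < z.im) : Ghat n 0 1 z - cst n = gg c n z + ex z (-1) ^ n := by
  have key : ∀ x ∈ n.divisorsAntidiagonal, gp c x.1 x.2 z =
      ∑ s ∈ Finset.range x.2, HH s x.2 ((x.1 * z + s) / x.2) - (if Even x.2 then (12 * x.2 : ℂ) else 0)
        - if x = (n, 1) then ex z (-n) else 0 := by
    intro x hx
    rw [Nat.mem_divisorsAntidiagonal] at hx
    have h1 : 0 < x.1 := Nat.pos_of_ne_zero (by intro h; rw [h] at hx; simp at hx; omega)
    have h2 : 0 < x.2 := Nat.pos_of_ne_zero (by intro h; rw [h] at hx; simp at hx; omega)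
    rw [(h.gp_hasSum x.1 x.2 h1 h2 hz).unique (h.part x.1 x.2 h1 h2 hz)]
    congr 1
    by_cases h3 : x.2 = 1
    · have : x = (n, 1) := by
        rw [h3, mul_one] at hx; ext
        · exact hx.1
        · exact h3
      rw [if_pos h3, if_pos this, this]
    · have : x ≠ (n, 1) := by rintro rfl; simp at h3
      rw [if_neg h3, if_neg this]
  rw [gg, Finset.sum_congr rfl key, Ghat_eq n hn, cst, Finset.sum_sub_distrib, Finset.sum_sub_distrib,
    Finset.sum_ite_eq' , if_pos (by simp [hn.ne'])]
  have e : ex z (-1) ^ n = ex z (-n) := by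
    rw [ex_zpow z (-1), ex_zpow z (-n), ← zpow_natCast, ← zpow_mul]; simp
  rw [e]
  simp

lemma CD.gg_bound {c : ZMod 2 → ZMod 2 → ℤ → ℤ} (h : CD c) (n : ℕ) : ∃ C : ℝ, 0 ≤ C ∧
    ∀ z : ℂ, 1 ≤ z.im → ‖gg c n z‖ ≤ C * ‖ex z 1‖ := by
  have key : ∀ x : ℕ × ℕ, ∃ C : ℝ, 0 ≤ C ∧ (x ∈ n.divisorsAntidiagonal →
      ∀ z : ℂ, 1 ≤ z.im → ‖gp c x.1 x.2 z‖ ≤ C * ‖ex z 1‖) := by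
    intro x
    by_cases hx : x ∈ n.divisorsAntidiagonal
    swap
    · exact ⟨0, le_rfl, fun h => absurd h hx⟩
    rw [Nat.mem_divisorsAntidiagonal] at hx
    have h1 : 0 < x.1 := Nat.pos_of_ne_zero (by intro h; rw [h] at hx; simp at hx; omega)
    have h2 : 0 < x.2 := Nat.pos_of_ne_zero (by intro h; rw [h] at hx; simp at hx; omega)
    have h1' : (1:ℝ) ≤ x.1 := by exact_mod_cast h1
    have hexk : ∀ (z : ℂ) (r : ℤ), ex z (r * x.1) = ex (x.1 * z) r := by
      intro z r; rw [ex, ex]; congr 1; push_cast; ring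
    obtain ⟨M, hM, hb⟩ := bnd (fun r => (x.2 : ℂ) * (ep c x.2 r : ℂ)) 1
      (fun r hr => by rw [ep, if_pos (by omega)]; simp) x.1 (summable_norm_of_hasSum _ _ (gp c x.1 x.2 Complex.I) (by
        refine hsc (h.gp_hasSum x.1 x.2 h1 h2 (z := Complex.I) (by simp)) (fun r => ?_) rfl
        rw [hexk]; simp))
    refine ⟨M * Real.exp π, by positivity, fun _ z hz => ?_⟩
    have := hb (x.1 * z) _ (by simp; nlinarith) (by
        refine hsc (h.gp_hasSum x.1 x.2 h1 h2 (z := z) (by linarith)) (fun r => ?_) rfl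
        rw [hexk])
    refine this.trans ?_
    rw [norm_ex, mul_assoc M, ← Real.exp_add]
    gcongr
    simp
    have h3 := Real.pi_pos
    nlinarith [mul_nonneg h3.le (mul_nonneg (sub_nonneg.2 h1') (sub_nonneg.2 hz))]
  choose C hC hb using key
  refine ⟨∑ x ∈ n.divisorsAntidiagonal, C x, Finset.sum_nonneg fun x _ => hC x, fun z hz => ?_⟩
  rw [gg, Finset.sum_mul]
  exact norm_sum_le_of_le _ fun x hx => hb x hx z hz

lemma rc_trunc (g g' : ℕ → ℂ) (N : ℕ) (h : ∀ n, 0 < n → n ≤ N → g n = g' n) (n : ℕ) (hn : n ≤ N) :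
    rc g n = rc g' n := by
  induction n using Nat.strong_induction_on with
  | _ n ih =>
    cases n with
    | zero => rw [rc_zero, rc_zero]
    | succ n =>
      rw [rc_succ, rc_succ]
      congr 2
      refine Finset.sum_congr rfl fun x hx => ?_
      have := Finset.HasAntidiagonal.mem_antidiagonal.1 hx
      rw [ih x.2 (by omega) (by omega), h _ (Nat.succ_pos _) (by omega)]

lemma HH_diff (a b : ZMod 2) {z : ℂ} (hz : 0 < z.im) : DifferentiableAt ℂ (HH a b) z := by
  unfold HH
  rcases zm2 a with rfl | rfl <;> rcases zm2 b with rfl | rfl <;> simp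
  · exact ftNS_diff hz
  · exact fR_diff hz
  · exact fNS_diff hz

lemma div_pos_of_mem {n : ℕ} {x : ℕ × ℕ} (hx : x ∈ n.divisorsAntidiagonal) : 0 < x.1 ∧ 0 < x.2 := by
  rw [Nat.mem_divisorsAntidiagonal] at hx
  constructor
  · exact Nat.pos_of_ne_zero (by intro h; rw [h] at hx; simp at hx; omega)
  · exact Nat.pos_of_ne_zero (by intro h; rw [h] at hx; simp at hx; omega)

lemma Ghat_diff (n : ℕ) (hn : 0 < n) (v0 v1 : ZMod 2) {z : ℂ} (hz : 0 < z.im) :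
    DifferentiableAt ℂ (Ghat n v0 v1) z := by
  have : Ghat n v0 v1 = fun z => ∑ x ∈ n.divisorsAntidiagonal, ∑ s ∈ Finset.range x.2,
      HH (x.1 * v0 + s * v1) (x.2 * v1) ((x.1 * z + s) / x.2) := by
    ext z; exact Ghat_eq n hn v0 v1 z
  rw [this]
  refine DifferentiableAt.fun_sum fun x hx => DifferentiableAt.fun_sum fun s _ => ?_
  obtain ⟨h1, h2⟩ := div_pos_of_mem hx
  exact DifferentiableAt.comp z (HH_diff _ _ (im_lin_pos x.1 x.2 s h1 h2 hz)) (by fun_prop)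

open ModularGroup in
lemma CD.Ghat_S {c : ZMod 2 → ZMod 2 → ℤ → ℤ} (h : CD c) (n : ℕ) (hn : 0 < n)
    (v0 v1 : ZMod 2) {z : ℂ} (hz : 0 < z.im) : Ghat n v1 v0 (-1 / z) = Ghat n v0 v1 z := by
  have := h.Ghat_inv n hn S v0 v1 hz
  rw [show mob S.1 z = -1 / z by simp [mob, S]] at this
  rw [← this]
  congr 1
  · rcases zm2 v0 with rfl | rfl <;> rcases zm2 v1 with rfl | rfl <;> simp [S] 
  · simp [S]

open ModularGroup in
lemma CD.Ghat_T {c : ZMod 2 → ZMod 2 → ℤ → ℤ} (h : CD c) (n : ℕ) (hn : 0 < n)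
    (v0 v1 : ZMod 2) {z : ℂ} (hz : 0 < z.im) : Ghat n (v0 + v1) v1 (z + 1) = Ghat n v0 v1 z := by
  have := h.Ghat_inv n hn T v0 v1 hz
  rw [show mob T.1 z = z + 1 by simp [mob, T]] at this
  rw [← this]
  congr 1
  · simp [T]
  · simp [T]

noncomputable def AA (n : ℕ) (v0 v1 : ZMod 2) (z : ℂ) : ℂ := rc (fun k => Ghat k v0 v1 z - cst k) n

lemma CD.AA_bd2 {c : ZMod 2 → ZMod 2 → ℤ → ℤ} (h : CD c) (n : ℕ) :
    ∃ M B : ℝ, 0 < B ∧ ∀ z : ℂ, B ≤ z.im → ‖AA n 1 0 z‖ ≤ M := by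
  obtain ⟨M, hM, hb⟩ := h.bd01
  have hH : ∀ a : ZMod 2, ∀ z : ℂ, 1 ≤ z.im → ‖HH a 0 z‖ ≤ 2 * M + 24 := by
    intro a z hz
    rcases zm2 a with rfl | rfl
    · simp [HH]; positivity
    · have e : HH 1 0 z = -2 * (-(fR z + 24) / 2) - 24 := by simp [HH]; ring
      rw [e]
      refine (norm_sub_le _ _).trans ?_
      rw [norm_mul]
      have := hb z hz
      norm_num
      norm_num at this
      linarith
  obtain ⟨D, hD, hD2⟩ := rc_bound (fun k => (∑ x ∈ k.divisorsAntidiagonal, ∑ s ∈ Finset.range x.2, (2 * M + 24)) + ‖cst k‖)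
    (fun k => by positivity) n
  refine ⟨D, n + 1, by positivity, fun z hz => ?_⟩
  rw [AA, rc_trunc _ (fun k => if k ≤ n then Ghat k 1 0 z - cst k else 0) n
    (fun k _ hk => by rw [if_pos hk]) n le_rfl]
  refine (hD2 _ 1 (by norm_num) le_rfl (fun k hk => ?_)).1
  rw [mul_one]
  split_ifs with hkn
  · refine (norm_sub_le _ _).trans (add_le_add_left ?_ _)
    rw [Ghat_eq k hk]
    refine norm_sum_le_of_le _ fun x hx => norm_sum_le_of_le _ fun s _ => ?_
    rw [mul_zero]
    obtain ⟨h1, h2⟩ := div_pos_of_mem hx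
    apply hH
    rw [im_lin _ _ _ h2, le_div_iff₀ (by exact_mod_cast h2)]
    rw [Nat.mem_divisorsAntidiagonal] at hx
    have h3 : x.2 ≤ n := le_trans (by nlinarith [hx.1]) hkn
    have h3' : (x.2 : ℝ) ≤ n := by exact_mod_cast h3
    have h1' : (1 : ℝ) ≤ x.1 := by exact_mod_cast h1
    nlinarith
  · rw [norm_zero]; positivity

lemma CD.AA_bd0 {c : ZMod 2 → ZMod 2 → ℤ → ℤ} (h : CD c) (n : ℕ) :
    ∃ M B : ℝ, 0 < B ∧ ∀ z : ℂ, B ≤ z.im → ‖AA (n + 2) 0 1 z‖ ≤ M := by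
  choose C hC hb using h.gg_bound
  obtain ⟨D, hD, hD2⟩ := rc_bound C hC (n + 2)
  obtain ⟨D', hD', hD2'⟩ := rc_bound C hC (n + 1)
  refine ⟨D + D', 1, by norm_num, fun z hz => ?_⟩
  have hz0 : 0 < z.im := by linarith
  rw [AA, rc_congr _ (fun n => gg c n z + ex z (-1) ^ n) (fun n hn => h.Ghat_gg n hn hz0), rc_pole]
  have h1 : ‖ex z 1‖ ≤ 1 := by
    rw [norm_ex, Real.exp_le_one_iff]
    have := Real.pi_pos
    push_cast; nlinarith
  have a1 := (hD2 (fun n => gg c n z) ‖ex z 1‖ (norm_nonneg _) h1 (fun k _ => hb k z hz)).1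
  have a2 := (hD2' (fun n => gg c n z) ‖ex z 1‖ (norm_nonneg _) h1 (fun k _ => hb k z hz)).2 (by omega)
  refine (norm_sub_le _ _).trans (add_le_add a1 ?_)
  rw [norm_mul]
  calc _ ≤ ‖ex z (-1)‖ * (D' * ‖ex z 1‖) := by gcongr
    _ = D' * (‖ex z (-1)‖ * ‖ex z 1‖) := by ring
    _ = D' := by rw [← norm_mul, ex_zpow z (-1), zpow_neg_one, inv_mul_cancel₀ (ex_ne _ _)]; simp

lemma CD.AA_const {c : ZMod 2 → ZMod 2 → ℤ → ℤ} (h : CD c) (n : ℕ) :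
    ∀ z w : ℂ, 0 < z.im → 0 < w.im → AA (n + 2) 0 1 z = AA (n + 2) 0 1 w := by
  have hd : ∀ v0 v1 : ZMod 2, ∀ z : ℂ, 0 < z.im → DifferentiableAt ℂ (AA (n + 2) v0 v1) z := by
    intro v0 v1 z hz
    exact rc_diff (fun k z => Ghat k v0 v1 z - cst k) z (fun k hk => (Ghat_diff k hk v0 v1 hz).sub_const _) _
  have e : (1 + 1 : ZMod 2) = 0 := by decide
  have hT : ∀ v0 v1 : ZMod 2, ∀ z : ℂ, 0 < z.im → AA (n + 2) (v0 + v1) v1 (z + 1) = AA (n + 2) v0 v1 z := by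
    intro v0 v1 z hz
    exact rc_congr _ _ (fun k hk => by rw [h.Ghat_T k hk _ _ hz]) _
  have hS : ∀ v0 v1 : ZMod 2, ∀ z : ℂ, 0 < z.im → AA (n + 2) v1 v0 (-1 / z) = AA (n + 2) v0 v1 z := by
    intro v0 v1 z hz
    exact rc_congr _ _ (fun k hk => by rw [h.Ghat_S k hk _ _ hz]) _
  refine const_of_triple (AA (n + 2) 0 1) (AA (n + 2) 1 1) (AA (n + 2) 1 0) (hd _ _) (hd _ _) (hd _ _)
    ?_ ?_ ?_ ?_ ?_ ?_ (h.AA_bd0 n) (h.AA_bd2 _)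
  · intro z hz; simpa [e] using hT 1 1 z hz
  · intro z hz; simpa [e] using hT 0 1 z hz
  · intro z hz; simpa [e] using hT 1 0 z hz
  · exact hS 1 0
  · exact hS 1 1
  · exact hS 0 1

lemma AA_one (z : ℂ) : AA 1 0 1 z = - ftNS z := by
  rw [AA, rc_succ, Finset.HasAntidiagonal.antidiagonal_zero]
  simp [rc_zero, Ghat_eq 1 one_pos, cst, HH]

/-- coefficients of `(1 - p/y) exp L` -/
lemma CD.AA_gg {c : ZMod 2 → ZMod 2 → ℤ → ℤ} (h : CD c) (n : ℕ) {z : ℂ} (hz : 0 < z.im) :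
    AA (n + 1) 0 1 z = rc (fun n => gg c n z) (n + 1) - ex z (-1) * rc (fun n => gg c n z) n := by
  rw [AA, rc_congr _ (fun n => gg c n z + ex z (-1) ^ n) (fun n hn => h.Ghat_gg n hn hz), rc_pole]

lemma ps_ball (a : ℕ → ℂ) (R : NNReal) (hR : 0 < R) (L : ℂ → ℂ)
    (hL : ∀ p : ℂ, ‖p‖ < R → HasSum (fun n : ℕ => a n * p ^ n) (L p)) :
    HasFPowerSeriesOnBall L (FormalMultilinearSeries.ofScalars ℂ a) 0 R := by
  refine ⟨?_, by exact_mod_cast hR, ?_⟩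
  · refine ENNReal.le_of_forall_nnreal_lt fun r hr => ?_
    have hr' : r < R := by exact_mod_cast hr
    have h1 := (hL ((r : ℝ) : ℂ) (by simpa using hr')).summable.norm
    apply FormalMultilinearSeries.le_radius_of_summable
    refine h1.of_nonneg_of_le (fun n => by positivity) fun n => ?_
    rw [norm_mul, norm_pow]
    simp
  · intro y hy
    rw [zero_add]
    have hy' : ‖y‖ < R := by simpa [Metric.eball_coe] using hy
    refine hsc (hL y hy') (fun n => ?_) rfl
    simp [mul_comm]

lemma ps_iter (a : ℕ → ℂ) (R : NNReal) (hR : 0 < R) (L : ℂ → ℂ)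
    (hL : ∀ p : ℂ, ‖p‖ < R → HasSum (fun n : ℕ => a n * p ^ n) (L p)) (n : ℕ) :
    iteratedDeriv n L 0 = n.factorial * a n := by
  have h := ps_ball a R hR L hL
  have := h.factorial_smul (1 : ℂ) n
  rw [iteratedDeriv_eq_iteratedFDeriv, ← this]
  simp

lemma exp_series (g : ℕ → ℂ) (R : NNReal) (hR : 0 < R) (L : ℂ → ℂ)
    (hL : ∀ p : ℂ, ‖p‖ < R → HasSum (fun n : ℕ => -g n / n * p ^ n) (L p)) (p : ℂ) (hp : ‖p‖ < R) :
    HasSum (fun n : ℕ => rc g n * p ^ n) (Complex.exp (L p)) := by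
  have h := ps_ball _ R hR L hL
  have hLd : DifferentiableOn ℂ L (Metric.ball 0 R) := by
    have := h.differentiableOn
    rwa [Metric.eball_coe] at this
  have hFd : DifferentiableOn ℂ (fun p => Complex.exp (L p)) (Metric.ball 0 R) := hLd.cexp
  have h0 : L 0 = 0 := by
    refine (hL 0 (by simpa using hR)).unique ?_
    refine hsc hasSum_zero (fun n => ?_) rfl
    cases n <;> simp
  have han : AnalyticAt ℂ L 0 := h.analyticAt
  have hFan : AnalyticAt ℂ (fun p => Complex.exp (L p)) 0 := han.cexp
  set F := fun p => Complex.exp (L p) with hF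
  have hco : ∀ n, (n.factorial : ℂ)⁻¹ * iteratedDeriv n F 0 = rc g n := by
    refine rc_unique g (fun n => (n.factorial : ℂ)⁻¹ * iteratedDeriv n F 0) (by simp [hF, h0]) ?_
    intro n
    have hev : deriv F =ᶠ[nhds 0] (deriv L * F) := by
      filter_upwards [Metric.ball_mem_nhds (0:ℂ) (show (0:ℝ) < R by exact_mod_cast hR)] with x hx
      have hx' := (hLd.differentiableAt (Metric.isOpen_ball.mem_nhds hx))
      simp only [hF, Pi.mul_apply]
      rw [hx'.hasDerivAt.cexp.deriv, mul_comm]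
    have hn : (n.factorial : ℂ) ≠ 0 := by exact_mod_cast n.factorial_ne_zero
    have hn1 : (n:ℂ) + 1 ≠ 0 := by exact_mod_cast Nat.succ_ne_zero n
    rw [iteratedDeriv_succ', hev.iteratedDeriv_eq n, iteratedDeriv_mul han.deriv.contDiffAt hFan.contDiffAt,
      Finset.Nat.sum_antidiagonal_eq_sum_range_succ_mk, Nat.factorial_succ]
    push_cast
    rw [mul_inv, ← mul_assoc, ← mul_assoc, mul_inv_cancel₀ hn1, one_mul, Finset.mul_sum, ← Finset.sum_neg_distrib]
    refine Finset.sum_congr rfl fun i hi => ?_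
    have hi' : i ≤ n := by have := Finset.mem_range.1 hi; omega
    rw [← iteratedDeriv_succ', ps_iter _ R hR L hL, Nat.factorial_succ]
    have hi1 : (i:ℂ) + 1 ≠ 0 := by exact_mod_cast Nat.succ_ne_zero i
    have hif : (i.factorial : ℂ) ≠ 0 := by exact_mod_cast i.factorial_ne_zero
    have hnif : ((n - i).factorial : ℂ) ≠ 0 := by exact_mod_cast (n - i).factorial_ne_zero
    have hch : (n.choose i : ℂ) * i.factorial * (n - i).factorial = n.factorial := by
      exact_mod_cast Nat.choose_mul_factorial_mul_factorial hi'
    push_cast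
    rw [← hch] at hn ⊢
    have hc0 : (n.choose i : ℂ) ≠ 0 := fun h => hn (by rw [h]; ring)
    field_simp
  have := Complex.hasSum_taylorSeries_on_ball hFd (z := p) (by simpa using hp)
  refine hsc this (fun n => ?_) rfl
  rw [← hco n, smul_eq_mul, smul_eq_mul, sub_zero]; ring

lemma CD.ep_bound {c : ZMod 2 → ZMod 2 → ℤ → ℤ} (h : CD c) : ∃ K : ℝ, 0 ≤ K ∧ ∀ (d : ℕ) (r : ℤ), 0 < d →
    ‖(ep c d r : ℂ)‖ ≤ K * Real.exp π ^ d * Real.exp π ^ r.natAbs := by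
  obtain ⟨K, hK, hb⟩ := h.growth
  refine ⟨K, hK, fun d r hd => ?_⟩
  rw [ep]
  split_ifs with hr
  · simp; positivity
  · push Not at hr
    lift r to ℕ using hr.le
    have hr' : 0 < r := by exact_mod_cast hr
    have hm : (1:ℤ) ≤ (r:ℤ) * d := by exact_mod_cast Nat.mul_pos hr' hd
    refine (hb _ _ _ hm).trans ?_
    rw [mul_assoc K, ← pow_add, ← Real.exp_nat_mul]
    refine mul_le_mul_of_nonneg_left (Real.exp_le_exp.2 ?_) hK
    have h1 : √(((r:ℤ) * (d:ℤ) : ℤ) : ℝ) ≤ ((r:ℝ) + d) / 2 := by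
      apply Real.sqrt_le_iff.2 ⟨by positivity, ?_⟩
      push_cast
      nlinarith [sq_nonneg ((r:ℝ) - d)]
    have h2 := Real.pi_pos
    push_cast
    simp only [Int.natAbs_natCast]
    push_cast at h1
    nlinarith

noncomputable def TT (c : ZMod 2 → ZMod 2 → ℤ → ℤ) (z p : ℂ) (i : (ℕ+ × ℕ+) × ℤ) : ℂ :=
  (ep c i.1.2 i.2 : ℂ) * (p ^ (i.1.2 : ℕ) * ex z i.2) ^ (i.1.1 : ℕ) / ((i.1.1 : ℕ) : ℂ)

noncomputable def dl : ℝ := Real.exp (-π) / 2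

lemma dl_pos : 0 < dl := by unfold dl; positivity
lemma dl_half : dl ≤ 1 / 2 := by
  unfold dl
  have : Real.exp (-π) ≤ 1 := Real.exp_le_one_iff.2 (by linarith [Real.pi_pos])
  linarith
lemma dl_exp : Real.exp π * dl = 1 / 2 := by
  unfold dl
  rw [← mul_div_assoc, ← Real.exp_add]; simp

lemma half_int : Summable (fun r : ℤ => ((1:ℝ) / 2) ^ r.natAbs) := by
  apply Summable.of_nat_of_neg <;> simpa using summable_geometric_two

lemma half_pnat : Summable (fun r : ℕ+ => ((1:ℝ) / 2) ^ (r : ℕ)) :=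
  summable_geometric_two.comp_injective PNat.coe_injective

lemma norm_ex_pow (z : ℂ) (r : ℕ) : ‖ex z r‖ = ‖ex z 1‖ ^ r := by
  rw [ex_zpow, norm_zpow]; simp

lemma CD.TT_summable {c : ZMod 2 → ZMod 2 → ℤ → ℤ} (h : CD c) {z p : ℂ} (hy : ‖ex z 1‖ ≤ dl) (hp : ‖p‖ ≤ dl) :
    Summable (TT c z p) := by
  obtain ⟨K, hK, hb⟩ := h.ep_bound
  have hs : Summable (fun i : (ℕ+ × ℕ+) × ℤ =>
      (2 * K) * ((((1:ℝ) / 2) ^ (i.1.1 : ℕ) * ((1:ℝ) / 2) ^ (i.1.2 : ℕ)) * ((1:ℝ) / 2) ^ i.2.natAbs)) := by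
    apply Summable.mul_left
    exact (half_pnat.mul_of_nonneg half_pnat (fun _ => by positivity) (fun _ => by positivity)).mul_of_nonneg
      half_int (fun _ => by positivity) (fun _ => by positivity)
  refine Summable.of_norm_bounded hs fun ⟨⟨k, d⟩, r⟩ => ?_
  simp only [TT]
  have hk : 0 < (k:ℕ) := k.pos
  have hd : 0 < (d:ℕ) := d.pos
  generalize (k:ℕ) = k at hk ⊢
  generalize (d:ℕ) = d at hd ⊢
  have hk1 : (1:ℝ) ≤ k := by exact_mod_cast hk
  by_cases hr : r ≤ 0
  · rw [ep, if_pos hr]; simp; positivity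
  push Not at hr
  have hb1 := hb d r hd
  lift r to ℕ using hr.le
  have hr' : 0 < r := by exact_mod_cast hr
  rw [Int.natAbs_natCast] at *
  rw [norm_div, norm_mul, norm_pow, norm_mul, norm_pow, norm_ex_pow, Complex.norm_natCast]
  refine (div_le_self (by positivity) hk1).trans ?_
  have h0 := dl_pos.le
  have hh := dl_half
  have hx : ‖p‖ ^ d * ‖ex z 1‖ ^ r ≤ dl ^ d * dl ^ r := by gcongr
  have hx2 : dl ^ d * dl ^ r ≤ 1 / 2 := by
    have a1 : dl ^ d ≤ dl := pow_le_of_le_one h0 (by linarith) hd.ne'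
    have a2 : dl ^ r ≤ 1 := pow_le_one₀ h0 (by linarith)
    calc _ ≤ dl * 1 := by gcongr
      _ ≤ _ := by linarith
  obtain ⟨k, rfl⟩ : ∃ m, k = m + 1 := ⟨k - 1, by omega⟩
  have hx3 : (‖p‖ ^ d * ‖ex z 1‖ ^ r) ^ (k + 1) ≤ (1 / 2) ^ k * (dl ^ d * dl ^ r) := by
    rw [pow_succ]
    gcongr
    exact hx.trans hx2
  calc _ ≤ (K * Real.exp π ^ d * Real.exp π ^ r) * ((1 / 2) ^ k * (dl ^ d * dl ^ r)) := by gcongr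
    _ = K * (1 / 2) ^ k * (Real.exp π * dl) ^ d * (Real.exp π * dl) ^ r := by rw [mul_pow, mul_pow]; ring
    _ = _ := by rw [dl_exp, pow_succ]; ring

lemma CD.TT_gg {c : ZMod 2 → ZMod 2 → ℤ → ℤ} (h : CD c) {z p : ℂ} (hz : 0 < z.im)
    (hy : ‖ex z 1‖ ≤ dl) (hp : ‖p‖ ≤ dl) :
    HasSum (fun n : ℕ => -gg c n z / n * p ^ n) (-∑' i, TT c z p i) := by
  have h1 := (h.TT_summable hy hp).hasSum
  have h2 := h1.prod_fiberwise (g := fun x : ℕ+ × ℕ+ => gp c x.1 x.2 z / ((x.1 : ℕ) * (x.2 : ℕ) : ℂ) * p ^ ((x.1:ℕ) * x.2)) (by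
    rintro ⟨k, d⟩
    have hk : ((k:ℕ):ℂ) ≠ 0 := by exact_mod_cast k.ne_zero
    have hd : ((d:ℕ):ℂ) ≠ 0 := by exact_mod_cast d.ne_zero
    refine hsc ((h.gp_hasSum k d k.pos d.pos hz).mul_left (p ^ ((k:ℕ) * d) / (k * d : ℂ))) (fun r => ?_) (by ring)
    simp only [TT]
    have e : ex z (r * (k:ℕ)) = ex z r ^ (k:ℕ) := by
      rw [ex_zpow z (r * (k:ℕ)), ex_zpow z r, zpow_mul, zpow_natCast]
    rw [e, mul_pow, ← pow_mul, mul_comm (d:ℕ) (k:ℕ)]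
    field_simp)
  rw [← sigmaAntidiagonalEquivProd.hasSum_iff] at h2
  have h3 := h2.sigma (g := fun n : ℕ+ => gg c n z / (n : ℕ) * p ^ (n : ℕ)) (by
    intro n
    refine hsc (hasSum_fintype _) (fun _ => rfl) ?_
    rw [gg, Finset.sum_div, Finset.sum_mul, ← Finset.sum_attach]
    refine Finset.sum_congr rfl fun x hx => ?_
    have hx' := Nat.mem_divisorsAntidiagonal.1 x.2
    simp only [Function.comp, sigmaAntidiagonalEquivProd, Equiv.coe_fn_mk, divisorsAntidiagonalFactors, PNat.mk_coe]
    have e1 : ((n:ℕ):ℂ) = (x.1.1 : ℂ) * (x.1.2 : ℂ) := by exact_mod_cast hx'.1.symm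
    rw [e1, hx'.1])
  have h4 := (Function.Injective.hasSum_iff PNat.coe_injective (f := fun n : ℕ => gg c n z / n * p ^ n) (by
    intro n hn
    have : n = 0 := by
      by_contra h0
      exact hn ⟨⟨n, Nat.pos_of_ne_zero h0⟩, rfl⟩
    simp [this])).1 h3
  refine hsc h4.neg (fun n => by ring) rfl

lemma CD.TT_prod {c : ZMod 2 → ZMod 2 → ℤ → ℤ} (h : CD c) {z p : ℂ}
    (hy : ‖ex z 1‖ ≤ dl) (hp : ‖p‖ ≤ dl) :
    HasProd (fun x : ℕ+ × ℤ => (1 - p ^ (x.1 : ℕ) * ex z x.2) ^ ep c x.1 x.2) (Complex.exp (-∑' i, TT c z p i)) := by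
  have h1 := (h.TT_summable hy hp).hasSum
  let e : (ℕ+ × ℤ) × ℕ+ ≃ (ℕ+ × ℕ+) × ℤ :=
    ⟨fun x => ((x.2, x.1.1), x.1.2), fun x => ((x.1.2, x.2), x.1.1), fun _ => rfl, fun _ => rfl⟩
  rw [← e.hasSum_iff] at h1
  have hh := dl_half
  have hsm : ∀ (d : ℕ+) (r : ℤ), 0 < r → ‖p ^ (d:ℕ) * ex z r‖ < 1 := by
    intro d r hr
    lift r to ℕ using hr.le
    rw [norm_mul, norm_pow, norm_ex_pow]
    have a1 : ‖p‖ ^ (d:ℕ) ≤ ‖p‖ := pow_le_of_le_one (norm_nonneg _) (by linarith) d.ne_zero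
    have a2 : ‖ex z 1‖ ^ r ≤ 1 := pow_le_one₀ (norm_nonneg _) (by linarith)
    calc _ ≤ ‖p‖ * 1 := by gcongr
      _ < 1 := by linarith
  have h2 := h1.prod_fiberwise (g := fun x : ℕ+ × ℤ => -((ep c x.1 x.2 : ℂ) * Complex.log (1 - p ^ (x.1 : ℕ) * ex z x.2))) (by
    rintro ⟨d, r⟩
    by_cases hr : r ≤ 0
    · refine hsc hasSum_zero (fun k => ?_) ?_
      · simp [e, TT, ep, hr]
      · simp [ep, hr]
    push Not at hr
    have := Complex.hasSum_taylorSeries_neg_log (hsm d r hr)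
    have := (Function.Injective.hasSum_iff PNat.coe_injective (by
      intro n hn
      have : n = 0 := by
        by_contra h0
        exact hn ⟨⟨n, Nat.pos_of_ne_zero h0⟩, rfl⟩
      simp [this])).2 this
    refine hsc (this.mul_left (ep c d r : ℂ)) (fun k => ?_) (by ring)
    simp [e, TT]; ring)
  have h3 := h2.neg.cexp
  have e3 : (fun x : ℕ+ × ℤ => (1 - p ^ (x.1 : ℕ) * ex z x.2) ^ ep c x.1 x.2) = 
     Complex.exp ∘ fun x : ℕ+ × ℤ => - -((ep c x.1 x.2 : ℂ) * Complex.log (1 - p ^ (x.1 : ℕ) * ex z x.2)) := by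
    ext ⟨d, r⟩
    simp only [Function.comp, neg_neg]
    by_cases hr : r ≤ 0
    · simp [ep, hr]
    push Not at hr
    have hne : 1 - p ^ (d:ℕ) * ex z r ≠ 0 := by
      intro h0
      have := hsm d r hr
      rw [← sub_eq_zero.1 h0] at this
      simp at this
    rw [Complex.exp_int_mul, Complex.exp_log hne]
  rw [e3]
  exact h3

lemma CD.V_sum {c : ZMod 2 → ZMod 2 → ℤ → ℤ} (h : CD c) {z p : ℂ} (hz : 0 < z.im)
    (hy : ‖ex z 1‖ ≤ dl) (hp : ‖p‖ < dl) :
    HasSum (fun n : ℕ => AA n 0 1 z * p ^ n)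
      ((1 - p * ex z (-1)) * Complex.exp (-∑' i, TT c z p i)) := by
  have h1 := exp_series (fun n => gg c n z) ⟨dl, dl_pos.le⟩ dl_pos (fun p => -∑' i, TT c z p i)
    (fun p hp => h.TT_gg hz hy (le_of_lt hp)) p hp
  have h2 := (hasSum_nat_add_iff' 1).2 h1
  have h3 := h2.sub (h1.mul_left (p * ex z (-1)))
  rw [← hasSum_nat_add_iff' 1]
  refine hsc h3 (fun n => ?_) ?_
  · rw [h.AA_gg n hz, pow_succ]; ring
  · simp [AA, rc_zero]; ring

lemma ex_small {z : ℂ} (hz : 2 < z.im) : ‖ex z 1‖ < dl := by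
  rw [norm_ex, dl]
  have h1 := Real.pi_gt_three
  have h2 : (2:ℝ) ≤ Real.exp π := by
    have := Real.add_one_le_exp π; linarith
  have h3 : Real.exp (-π * z.im * ((1:ℤ):ℝ)) < Real.exp (-π - π) := by
    apply Real.exp_lt_exp.2
    push_cast; nlinarith
  rw [Real.exp_sub] at h3
  refine h3.trans_le ?_
  gcongr

lemma CD.V_eq {c : ZMod 2 → ZMod 2 → ℤ → ℤ} (h : CD c) {z s : ℂ} (hz : 2 < z.im) (hs : 2 < s.im) :
    (1 - ex s 1 * ex z (-1)) * Complex.exp (-∑' i, TT c z (ex s 1) i) = ex s 1 * (ftNS s - ftNS z) := by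
  have hz0 : 0 < z.im := by linarith
  have hs0 : 0 < s.im := by linarith
  have h1 := h.V_sum hz0 (ex_small hz).le (ex_small hs)
  have h2 := h.V_sum hs0 (ex_small hs).le (ex_small hs)
  have e0 : ex s 1 * ex s (-1) = 1 := by
    rw [ex_zpow s (-1), zpow_neg_one, mul_inv_cancel₀ (ex_ne _ _)]
  rw [e0, sub_self, zero_mul] at h2
  have h3 := h1.sub h2
  rw [sub_zero] at h3
  have h4 := hasSum_single (f := fun n => AA n 0 1 z * ex s 1 ^ n - AA n 0 1 s * ex s 1 ^ n) 1 (by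
    intro n hn
    rcases n with _ | _ | n
    · simp [AA, rc_zero]
    · simp at hn
    · rw [h.AA_const n z s hz0 hs0, sub_self])
  rw [h3.unique h4, AA_one, AA_one]
  ring

lemma CD.final {c : ZMod 2 → ZMod 2 → ℤ → ℤ} (h : CD c) {σ τ : ℂ} (hs : 2 < σ.im) (ht : 2 < τ.im) :
    HasProd (fun dr : ℕ × ℤ =>
        (1 - (-1 : ℂ) ^ dr.2 * Complex.exp (2 * Real.pi * Complex.I * σ) ^ (dr.1 + 1) *
              Complex.exp (Real.pi * Complex.I * τ * dr.2)) ^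
          c ((dr.1 + 1 : ℕ) : ZMod 2) ((dr.2 : ZMod 2)) (dr.2 * (dr.1 + 1)))
        (Complex.exp (2 * Real.pi * Complex.I * σ) * (ftNS (2 * σ) + fNS τ)) := by
  have hs2 : 2 < (2 * σ).im := by simp; linarith
  have ht1 : 2 < (τ + 1).im := by simpa using ht
  have ep1 : Complex.exp (2 * Real.pi * Complex.I * σ) = ex (2 * σ) 1 := by
    rw [ex]; congr 1; push_cast; ring
  have hv := h.V_eq ht1 hs2
  rw [h.ft_T (by linarith), sub_neg_eq_add] at hv
  rw [ep1, ← hv]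
  have h1 := h.TT_prod (ex_small ht1).le (ex_small hs2).le
  have h2 := (hasProd_ite_eq ((1 : ℕ+), (-1 : ℤ)) (1 - ex (2 * σ) 1 * ex (τ + 1) (-1))).mul h1
  rw [← (Equiv.prodCongr Equiv.pnatEquivNat.symm (Equiv.refl ℤ)).hasProd_iff] at h2
  have e : (fun dr : ℕ × ℤ =>
        (1 - (-1 : ℂ) ^ dr.2 * ex (2 * σ) 1 ^ (dr.1 + 1) *
              Complex.exp (Real.pi * Complex.I * τ * dr.2)) ^
          c ((dr.1 + 1 : ℕ) : ZMod 2) ((dr.2 : ZMod 2)) (dr.2 * (dr.1 + 1))) =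
      (fun x : ℕ+ × ℤ => (if x = ((1 : ℕ+), (-1 : ℤ)) then (1 - ex (2 * σ) 1 * ex (τ + 1) (-1)) else 1) *
        (1 - ex (2 * σ) 1 ^ (x.1 : ℕ) * ex (τ + 1) x.2) ^ ep c x.1 x.2) ∘
        (Equiv.prodCongr Equiv.pnatEquivNat.symm (Equiv.refl ℤ)) := by
    ext ⟨d, r⟩
    have e1 : ((-1 : ℂ) ^ r * ex (2 * σ) 1 ^ (d + 1) * Complex.exp (Real.pi * Complex.I * τ * r)) =
        ex (2 * σ) 1 ^ (d + 1) * ex (τ + 1) r := by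
      rw [ex_one_add, show ex τ r = Complex.exp (Real.pi * Complex.I * τ * r) from rfl]; ring
    have e2 : c ((d + 1 : ℕ) : ZMod 2) (r : ZMod 2) (r * (d + 1)) = ee c (d + 1) r := by
      rw [ee]; push_cast; rfl
    simp only [Function.comp, Equiv.prodCongr_apply, Prod.map, Equiv.refl_apply, Equiv.pnatEquivNat_symm_apply,
      Nat.succPNat_coe, Nat.succ_eq_add_one]
    rw [e1, e2]
    have hx : ((Nat.succPNat d, r) = ((1 : ℕ+), (-1 : ℤ))) ↔ (d + 1 = 1 ∧ r = -1) := by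
      rw [Prod.mk.injEq, ← PNat.coe_inj]; simp
    rw [ep]
    split_ifs with hA hB hB
    · rw [h.ee_nonpos _ (Nat.succ_pos d) _ hB, if_pos (hx.1 hA), (hx.1 hA).1, (hx.1 hA).2]; simp
    · exact absurd ((hx.1 hA).2) (by omega)
    · rw [h.ee_nonpos _ (Nat.succ_pos d) _ hB, if_neg (fun h => hA (hx.2 h))]; simp
    · rw [one_mul]
  rw [e]
  exact h2

/-- there is `Y > 0` such that for `Im σ, Im τ > Y` the product over
    `d ≥ 1`, `r ∈ ℤ` of `(1 − (−1)^r p^d q^{r/2})^{C_{d mod 2, r mod 2}(rd/2)}`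
    converges (absolutely, i.e. unconditionally) to `p · (f̃_NS(2σ) + f_NS(τ))`. -/
theorem statement3 (c : ZMod 2 → ZMod 2 → ℤ → ℤ)
    -- `c i j m` is the Fourier coefficient `C_{i,j}(m/2)`; expansions `F_{i,j}(τ) = ∑ C_{i,j}(n) qⁿ`
    (hexp : ∀ (i j : ZMod 2) (τ : ℂ), 0 < τ.im →
      HasSum (fun m : ℤ => (c i j m : ℂ) * Complex.exp (Real.pi * Complex.I * τ * m))
        (Fcomp i j τ))
    -- `C_{0,0}` and `C_{0,1}` are supported on nonnegative integers
    (h00supp : ∀ m : ℤ, m < 0 ∨ ¬ (2 ∣ m) → c 0 0 m = 0)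
    (h01supp : ∀ m : ℤ, m < 0 ∨ ¬ (2 ∣ m) → c 0 1 m = 0)
    -- `C_{1,0} = −C_{0,0}`
    (h10 : ∀ m : ℤ, c 1 0 m = - c 0 0 m)
    -- `C_{1,1}` is supported on half-odd-integers `n ≥ −1/2`, with `C_{1,1}(−1/2) = 1`
    (h11supp : ∀ m : ℤ, m < -1 ∨ 2 ∣ m → c 1 1 m = 0)
    (h11pol : c 1 1 (-1) = 1) :
    ∃ Y > (0 : ℝ), ∀ σ τ : ℂ, Y < σ.im → Y < τ.im →
      HasProd (fun dr : ℕ × ℤ =>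
        (1 - (-1 : ℂ) ^ dr.2 * Complex.exp (2 * Real.pi * Complex.I * σ) ^ (dr.1 + 1) *
              Complex.exp (Real.pi * Complex.I * τ * dr.2)) ^
          c ((dr.1 + 1 : ℕ) : ZMod 2) ((dr.2 : ZMod 2)) (dr.2 * (dr.1 + 1)))
        (Complex.exp (2 * Real.pi * Complex.I * σ) * (ftNS (2 * σ) + fNS τ)) := by
  have h : CD c := ⟨hexp, h00supp, h01supp, h10, h11supp, h11pol⟩
  exact ⟨2, by norm_num, fun σ τ hs ht => h.final hs ht⟩
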